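/- arXiv:2507.15665 — 3 statements merged into one kernel-verified Lean document; each statement's English description precedes it below -/
import Mathlib

section
/- For every positive integer n, the determinant of the n×n matrix whose (i,j)-entry (0 ≤ i,j ≤ n−1) is 2^{j}·binom(2i+j+1, 2i+1) + binom(2i−j+1, 2i+1) equals 2·2^{n(n−1)} times the product over i = 1 to n of Γ(i)·Γ(4i−1)·Γ((3i−2)/2) / (Γ(3i)·Γ(3i−2)·Γ(i/2)). -/
open scoped BigOperators

/-- Generalized binomial coefficient: `binom α p = α(α−1)⋯(α−p+1)/p!`. -/
noncomputable def binom (α : ℤ) (p : ℕ) : ℝ :=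
  (∏ k ∈ Finset.range p, ((α : ℝ) - (k : ℝ))) / (p.factorial : ℝ)

open PowerSeries in
theorem one_add_X_mul_inv : (1 + X : ℝ⟦X⟧) * (1 + X)⁻¹ = 1 := PowerSeries.mul_inv_cancel _ (by simp)

open PowerSeries in
theorem one_sub_X_mul_inv : (1 - X : ℝ⟦X⟧) * (1 - X)⁻¹ = 1 := PowerSeries.mul_inv_cancel _ (by simp)

/-- The unit `1 + X` of the ring of real power series. -/
noncomputable def oneAddX : (PowerSeries ℝ)ˣ :=
  ⟨1 + PowerSeries.X, (1 + PowerSeries.X)⁻¹, one_add_X_mul_inv, by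
    rw [mul_comm]; exact one_add_X_mul_inv⟩

/-- The unit `1 - X` of the ring of real power series. -/
noncomputable def oneSubX : (PowerSeries ℝ)ˣ :=
  ⟨1 - PowerSeries.X, (1 - PowerSeries.X)⁻¹, one_sub_X_mul_inv, by
    rw [mul_comm]; exact one_sub_X_mul_inv⟩

theorem val_oneAddX : (oneAddX : PowerSeries ℝ) = 1 + PowerSeries.X := rfl

theorem val_oneSubX : (oneSubX : PowerSeries ℝ) = 1 - PowerSeries.X := rfl

/-- The coefficient of `X ^ p` in `(1 + X) ^ (2 * p + r) / (1 - X) ^ r`. -/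
noncomputable def midCoeff (p : ℕ) (r : ℤ) : ℝ :=
  PowerSeries.coeff p ((oneAddX ^ (2 * (p : ℤ) + r) * oneSubX ^ (-r) : (PowerSeries ℝ)ˣ) : PowerSeries ℝ)

theorem midCoeff_succ (p : ℕ) (r : ℤ) :
    midCoeff (p + 1) (r + 2) = midCoeff (p + 1) r + 4 * midCoeff p (r + 2) := by
  have h : ((oneAddX ^ (2 * ((p + 1 : ℕ) : ℤ) + (r + 2)) * oneSubX ^ (-(r + 2)) :
        (PowerSeries ℝ)ˣ) : PowerSeries ℝ) =
      ((oneAddX ^ (2 * ((p + 1 : ℕ) : ℤ) + r) * oneSubX ^ (-r) : (PowerSeries ℝ)ˣ) : PowerSeries ℝ)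
      + PowerSeries.C 4 * (PowerSeries.X * ((oneAddX ^ (2 * (p : ℤ) + (r + 2)) *
        oneSubX ^ (-(r + 2)) : (PowerSeries ℝ)ˣ) : PowerSeries ℝ)) := by
    have e1 : oneAddX ^ (2 * ((p + 1 : ℕ) : ℤ) + (r + 2)) * oneSubX ^ (-(r + 2)) =
        oneAddX ^ (2 : ℕ) * (oneAddX ^ (2 * (p : ℤ) + (r + 2)) * oneSubX ^ (-(r + 2))) := by
      rw [← mul_assoc, ← zpow_natCast, ← zpow_add]; congr 2; push_cast; ring
    have e2 : oneAddX ^ (2 * ((p + 1 : ℕ) : ℤ) + r) * oneSubX ^ (-r) =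
        oneSubX ^ (2 : ℕ) * (oneAddX ^ (2 * (p : ℤ) + (r + 2)) * oneSubX ^ (-(r + 2))) := by
      rw [mul_left_comm, ← zpow_natCast oneSubX, ← zpow_add]; congr 2 <;> (push_cast; ring)
    rw [e1, e2, Units.val_mul (oneAddX ^ 2), Units.val_mul (oneSubX ^ 2), Units.val_pow_eq_pow_val,
      Units.val_pow_eq_pow_val, val_oneAddX, val_oneSubX, map_ofNat]
    ring
  rw [midCoeff, h, map_add, PowerSeries.coeff_C_mul, PowerSeries.coeff_succ_X_mul]
  rfl

theorem midCoeff_zero_left (r : ℤ) : midCoeff 0 r = 1 := by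
  have h (u : (PowerSeries ℝ)ˣ) (hu : PowerSeries.constantCoeff (u : PowerSeries ℝ) = 1) (k : ℤ) :
      PowerSeries.constantCoeff ((u ^ k : (PowerSeries ℝ)ˣ) : PowerSeries ℝ) = 1 := by
    have h1 : Units.map (PowerSeries.constantCoeff (R := ℝ)).toMonoidHom u = 1 := by
      ext; exact hu
    have h2 : Units.map (PowerSeries.constantCoeff (R := ℝ)).toMonoidHom (u ^ k) = 1 := by
      rw [map_zpow, h1, one_zpow]
    exact congrArg Units.val h2
  rw [midCoeff, PowerSeries.coeff_zero_eq_constantCoeff_apply, Units.val_mul, map_mul,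
    h oneAddX (by simp [val_oneAddX]), h oneSubX (by simp [val_oneSubX]), mul_one]

theorem midCoeff_zero_right (p : ℕ) :
    (p.factorial : ℝ) * midCoeff p 0 = 2 ^ p * ∏ j ∈ Finset.range p, (1 + 2 * (j : ℝ)) := by
  have h : midCoeff p 0 = (p.centralBinom : ℝ) := by
    have : (oneAddX ^ (2 * (p : ℤ) + 0) * oneSubX ^ (-0 : ℤ) : (PowerSeries ℝ)ˣ) =
        oneAddX ^ (2 * p) := by
      rw [add_zero, neg_zero, zpow_zero, mul_one, ← zpow_natCast]; push_cast; rfl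
    have e : ((1 + PowerSeries.X : PowerSeries ℝ)) ^ (2 * p) =
        (((1 + Polynomial.X) ^ (2 * p) : Polynomial ℝ) : PowerSeries ℝ) := by simp
    rw [midCoeff, this, Units.val_pow_eq_pow_val, val_oneAddX, e, Polynomial.coeff_coe,
      Polynomial.coeff_one_add_X_pow, Nat.centralBinom]
  rw [h]
  clear h
  induction p with
  | zero => simp
  | succ p ih =>
    have := Nat.succ_mul_centralBinom_succ p
    have h2 : ((p : ℝ) + 1) * ((p + 1).centralBinom : ℝ) = 2 * (2 * p + 1) * (p.centralBinom : ℝ) := by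
      exact_mod_cast this
    rw [Finset.prod_range_succ, Nat.factorial_succ]
    push_cast
    linear_combination (p.factorial : ℝ) * h2 + 2 * (2 * (p : ℝ) + 1) * ih

theorem midCoeff_one_right (p : ℕ) : midCoeff p 1 = 4 ^ p := by
  have h : (oneAddX ^ (2 * (p : ℤ) + 1) * oneSubX ^ (-1 : ℤ) : (PowerSeries ℝ)ˣ) =
      oneAddX ^ (2 * p + 1) * oneSubX⁻¹ := by
    rw [zpow_neg_one, ← zpow_natCast]; push_cast; rfl
  have e : ((1 + PowerSeries.X : PowerSeries ℝ)) ^ (2 * p + 1) =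
      (((1 + Polynomial.X) ^ (2 * p + 1) : Polynomial ℝ) : PowerSeries ℝ) := by simp
  have e2 : ((oneSubX⁻¹ : (PowerSeries ℝ)ˣ) : PowerSeries ℝ) = PowerSeries.mk 1 := by
    rw [Units.inv_eq_of_mul_eq_one_right]
    rw [val_oneSubX, mul_comm]; exact PowerSeries.mk_one_mul_one_sub_eq_one ℝ
  rw [midCoeff, h, Units.val_mul, e2, Units.val_pow_eq_pow_val, val_oneAddX, e,
    PowerSeries.coeff_mul, Finset.Nat.sum_antidiagonal_eq_sum_range_succ_mk]
  simp only [Polynomial.coeff_coe, Polynomial.coeff_one_add_X_pow, PowerSeries.coeff_mk,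
    Pi.one_apply, mul_one]
  exact_mod_cast Nat.sum_range_choose_halfway p

theorem factorial_mul_midCoeff (p : ℕ) (r : ℤ) :
    (p.factorial : ℝ) * midCoeff p r = 2 ^ p * ∏ j ∈ Finset.range p, ((r : ℝ) + 1 + 2 * (j : ℝ)) := by
  induction p generalizing r with
  | zero => simp [midCoeff_zero_left]
  | succ p ih =>
    have step (r : ℤ) : ((p + 1).factorial : ℝ) * midCoeff (p + 1) (r + 2)
          - 2 ^ (p + 1) * ∏ j ∈ Finset.range (p + 1), (((r + 2 : ℤ) : ℝ) + 1 + 2 * (j : ℝ)) =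
        ((p + 1).factorial : ℝ) * midCoeff (p + 1) r
          - 2 ^ (p + 1) * ∏ j ∈ Finset.range (p + 1), ((r : ℝ) + 1 + 2 * (j : ℝ)) := by
      have h := ih (r + 2)
      have hp : ∏ j ∈ Finset.range (p + 1), ((r : ℝ) + 1 + 2 * (j : ℝ)) =
          (∏ j ∈ Finset.range p, (((r + 2 : ℤ) : ℝ) + 1 + 2 * (j : ℝ))) * ((r : ℝ) + 1) := by
        rw [Finset.prod_range_succ']
        congr 1
        · refine Finset.prod_congr rfl fun j _ => ?_
          push_cast; ring
        · simp
      rw [midCoeff_succ, hp, Finset.prod_range_succ, Nat.factorial_succ]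
      push_cast at h ⊢
      linear_combination 4 * ((p : ℝ) + 1) * h
    have even (k : ℤ) : ((p + 1).factorial : ℝ) * midCoeff (p + 1) (2 * k) - 2 ^ (p + 1) *
        ∏ j ∈ Finset.range (p + 1), (((2 * k : ℤ) : ℝ) + 1 + 2 * (j : ℝ)) = 0 := by
      induction k using Int.induction_on with
      | zero =>
        rw [mul_zero, midCoeff_zero_right]; simp
      | succ k hk => rw [mul_add, mul_one, step, hk]
      | pred k hk => rw [← step, ← hk]; ring_nf
    have odd (k : ℤ) : ((p + 1).factorial : ℝ) * midCoeff (p + 1) (2 * k + 1) - 2 ^ (p + 1) *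
        ∏ j ∈ Finset.range (p + 1), (((2 * k + 1 : ℤ) : ℝ) + 1 + 2 * (j : ℝ)) = 0 := by
      induction k using Int.induction_on with
      | zero =>
        have : ∏ j ∈ Finset.range (p + 1), ((1 : ℝ) + 1 + 2 * (j : ℝ)) =
            2 ^ (p + 1) * ((p + 1).factorial : ℝ) := by
          rw [← Finset.prod_range_add_one_eq_factorial, Nat.cast_prod]
          conv_rhs => enter [1]; rw [← Finset.card_range (p + 1), ← Finset.prod_const]
          rw [← Finset.prod_mul_distrib]
          refine Finset.prod_congr rfl fun j _ => ?_
          push_cast; ring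
        simp only [mul_zero, zero_add, Int.cast_one]
        rw [midCoeff_one_right, this, show (4 : ℝ) = 2 * 2 by norm_num, mul_pow]; ring
      | succ k hk => rw [mul_add, mul_one, add_right_comm, step, hk]
      | pred k hk => rw [← step, ← hk]; ring_nf
    obtain ⟨k, rfl | rfl⟩ := Int.even_or_odd' r
    · linarith [even k]
    · linarith [odd k]

/-- The coefficient of `X ^ k` in `1 / (1 - X ^ 2) ^ (p + 1)`. -/
noncomputable def evenChoose (p k : ℕ) : ℝ := if Even k then ((p + k / 2).choose p : ℝ) else 0

theorem evenChoose_add_two (p k : ℕ) :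
    evenChoose (p + 1) (k + 2) = evenChoose (p + 1) k + evenChoose p (k + 2) := by
  unfold evenChoose
  by_cases h : Even k
  · have h2 : Even (k + 2) := by simpa [Nat.even_add] using h
    simp only [if_pos h, if_pos h2]
    rw [Nat.add_div_right k (by norm_num)]
    have := Nat.choose_succ_succ (p + (k / 2 + 1)) p
    rw [show p + 1 + (k / 2).succ = (p + (k / 2 + 1)).succ by omega, this,
      show p + (k / 2 + 1) = p + 1 + k / 2 by omega]
    push_cast; ring
  · have h2 : ¬ Even (k + 2) := by simpa [Nat.even_add] using h
    simp [h, h2]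

theorem mk_evenChoose_mul (p : ℕ) :
    PowerSeries.mk (evenChoose p) * (1 - PowerSeries.X ^ 2) ^ (p + 1) = 1 := by
  induction p with
  | zero =>
    ext k
    rw [zero_add, pow_one, mul_sub, mul_one, map_sub, PowerSeries.coeff_mk, PowerSeries.coeff_mul_X_pow',
      PowerSeries.coeff_one]
    rcases k with _ | _ | k
    · simp [evenChoose]
    · simp [evenChoose]
    · simp [evenChoose, Nat.even_add]
  | succ p ih =>
    have : PowerSeries.mk (evenChoose (p + 1)) * (1 - PowerSeries.X ^ 2) =
        PowerSeries.mk (evenChoose p) := by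
      ext k
      rw [mul_sub, mul_one, map_sub, PowerSeries.coeff_mk, PowerSeries.coeff_mul_X_pow',
        PowerSeries.coeff_mk]
      rcases k with _ | _ | k
      · simp [evenChoose]
      · simp [evenChoose]
      · rw [if_pos (by omega), show k + 1 + 1 - 2 = k from rfl, PowerSeries.coeff_mk, evenChoose_add_two]
        ring
    rw [pow_succ', ← mul_assoc, this, ih]

theorem val_oneAddX_mul_oneSubX_zpow (p : ℕ) :
    (((oneAddX * oneSubX) ^ (-((p : ℤ) + 1)) : (PowerSeries ℝ)ˣ) : PowerSeries ℝ) =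
      PowerSeries.mk (evenChoose p) := by
  rw [zpow_neg, Units.inv_eq_of_mul_eq_one_right]
  rw [show ((p : ℤ) + 1) = ((p + 1 : ℕ) : ℤ) by push_cast; rfl, zpow_natCast,
    Units.val_pow_eq_pow_val, Units.val_mul, val_oneAddX, val_oneSubX, mul_comm,
    show (1 + PowerSeries.X) * (1 - PowerSeries.X) = (1 - PowerSeries.X ^ 2 : PowerSeries ℝ) by ring]
  exact mk_evenChoose_mul p

/-- The coefficient of `X ^ p` in `(x + y * X) ^ (4 * p + 2) / (1 - X ^ 2) ^ (p + 1)`. -/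
noncomputable def residueForm (p : ℕ) (x y : ℝ) : ℝ :=
  PowerSeries.coeff p ((PowerSeries.C x + PowerSeries.C y * PowerSeries.X) ^ (4 * p + 2) *
    PowerSeries.mk (evenChoose p))

theorem residueForm_eq_sum (p : ℕ) (x y : ℝ) :
    residueForm p x y = ∑ j ∈ Finset.range (p + 1),
      ((4 * p + 2).choose j : ℝ) * evenChoose p (p - j) * x ^ (4 * p + 2 - j) * y ^ j := by
  have h (m : ℕ) : PowerSeries.coeff p ((PowerSeries.C y * PowerSeries.X) ^ m *
      PowerSeries.C x ^ (4 * p + 2 - m) * ((4 * p + 2).choose m : PowerSeries ℝ) *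
      PowerSeries.mk (evenChoose p)) =
      if m ≤ p then ((4 * p + 2).choose m : ℝ) * evenChoose p (p - m) * x ^ (4 * p + 2 - m) * y ^ m
      else 0 := by
    have e : (PowerSeries.C y * PowerSeries.X) ^ m *
      PowerSeries.C x ^ (4 * p + 2 - m) * ((4 * p + 2).choose m : PowerSeries ℝ) *
      PowerSeries.mk (evenChoose p) = PowerSeries.C (y ^ m * x ^ (4 * p + 2 - m) *
        ((4 * p + 2).choose m : ℝ)) * (PowerSeries.X ^ m * PowerSeries.mk (evenChoose p)) := by
      simp only [map_mul, map_pow, map_natCast]; ring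
    rw [e, PowerSeries.coeff_C_mul, PowerSeries.coeff_X_pow_mul']
    split_ifs
    · rw [PowerSeries.coeff_mk]; ring
    · rw [mul_zero]
  rw [residueForm, add_comm, add_pow, Finset.sum_mul, map_sum, Finset.sum_congr rfl fun m _ => h m,
    ← Finset.sum_filter]
  refine Finset.sum_congr ?_ fun _ _ => rfl
  ext m; simp only [Finset.mem_filter, Finset.mem_range]; omega

theorem residueForm_smul (p : ℕ) (c x y : ℝ) :
    residueForm p (c * x) (c * y) = c ^ (4 * p + 2) * residueForm p x y := by
  rw [residueForm_eq_sum, residueForm_eq_sum, Finset.mul_sum]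
  refine Finset.sum_congr rfl fun j hj => ?_
  have hj : j ≤ 4 * p + 2 := by have := Finset.mem_range.1 hj; omega
  rw [mul_pow, mul_pow, ← Nat.sub_add_cancel hj, pow_add c, Nat.add_sub_cancel]
  ring

theorem residueForm_add_sub (p : ℕ) (x y : ℝ) :
    residueForm p (x + y) (x - y) = ∑ i ∈ Finset.range (4 * p + 2 + 1),
      ((4 * p + 2).choose i : ℝ) * midCoeff p (i - 3 * p - 1) * x ^ i * y ^ (4 * p + 2 - i) := by
  have e : PowerSeries.C (x + y) + PowerSeries.C (x - y) * PowerSeries.X =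
      PowerSeries.C x * (oneAddX : PowerSeries ℝ) + PowerSeries.C y * (oneSubX : PowerSeries ℝ) := by
    rw [val_oneAddX, val_oneSubX, map_add, map_sub]; ring
  rw [residueForm, e, add_pow, Finset.sum_mul, map_sum]
  refine Finset.sum_congr rfl fun i hi => ?_
  have hi : i ≤ 4 * p + 2 := by have := Finset.mem_range.1 hi; omega
  have e2 : (oneAddX ^ (2 * (p : ℤ) + (i - 3 * p - 1)) * oneSubX ^ (-((i : ℤ) - 3 * p - 1)) :
      (PowerSeries ℝ)ˣ) = oneAddX ^ i * oneSubX ^ (4 * p + 2 - i) *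
        (oneAddX * oneSubX) ^ (-((p : ℤ) + 1)) := by
    rw [mul_zpow, mul_mul_mul_comm, ← zpow_natCast, ← zpow_natCast, ← zpow_add, ← zpow_add]
    congr 2
    · ring
    · push_cast [Nat.cast_sub hi]; ring
  rw [midCoeff, e2, Units.val_mul, val_oneAddX_mul_oneSubX_zpow, Units.val_mul,
    Units.val_pow_eq_pow_val, Units.val_pow_eq_pow_val]
  have e3 : (PowerSeries.C x * (oneAddX : PowerSeries ℝ)) ^ i *
      (PowerSeries.C y * (oneSubX : PowerSeries ℝ)) ^ (4 * p + 2 - i) *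
      ((4 * p + 2).choose i : PowerSeries ℝ) * PowerSeries.mk (evenChoose p) =
      PowerSeries.C (((4 * p + 2).choose i : ℝ) * x ^ i * y ^ (4 * p + 2 - i)) *
      ((oneAddX : PowerSeries ℝ) ^ i * (oneSubX : PowerSeries ℝ) ^ (4 * p + 2 - i) *
        PowerSeries.mk (evenChoose p)) := by
    simp only [map_mul, map_pow, map_natCast]; ring
  rw [e3, PowerSeries.coeff_C_mul]
  ring

theorem midCoeff_neg (p : ℕ) (r : ℤ) : midCoeff p (-2 * p - r) = (-1) ^ p * midCoeff p r := by
  have h0 : (p.factorial : ℝ) ≠ 0 := by positivity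
  apply mul_left_cancel₀ h0
  rw [mul_left_comm, factorial_mul_midCoeff, factorial_mul_midCoeff, ← Finset.prod_range_reflect,
    mul_left_comm]
  congr 1
  conv_rhs => enter [1]; rw [← Finset.card_range p, ← Finset.prod_const]
  rw [← Finset.prod_mul_distrib]
  refine Finset.prod_congr rfl fun j hj => ?_
  have hj : j < p := Finset.mem_range.1 hj
  push_cast [Nat.cast_sub (show j ≤ p - 1 by omega), Nat.cast_sub (show 1 ≤ p by omega)]
  ring

theorem midCoeff_odd (p q : ℕ) : midCoeff p (2 * q + 1) = 4 ^ p * ((p + q).choose p : ℝ) := by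
  have h0 : (p.factorial : ℝ) ≠ 0 := by positivity
  apply mul_left_cancel₀ h0
  have h1 : (p.factorial : ℝ) * ((p + q).choose p : ℝ) = ∏ j ∈ Finset.range p, ((q : ℝ) + 1 + j) := by
    rw [← Nat.cast_mul, add_comm p q, ← Nat.ascFactorial_eq_factorial_mul_choose, Nat.ascFactorial_eq_prod_range]
    push_cast
    refine Finset.prod_congr rfl fun j _ => by ring
  rw [mul_left_comm, h1, factorial_mul_midCoeff, show (4 : ℝ) = 2 * 2 by norm_num, mul_pow, mul_assoc]
  congr 1
  conv_rhs => enter [1]; rw [← Finset.card_range p, ← Finset.prod_const]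
  rw [← Finset.prod_mul_distrib]
  refine Finset.prod_congr rfl fun j _ => ?_
  push_cast; ring

theorem midCoeff_eq_zero {p l : ℕ} (hl : l < 2 * p) (ho : Odd l) : midCoeff p (l - 2 * p) = 0 := by
  have h0 : (p.factorial : ℝ) ≠ 0 := by positivity
  apply mul_left_cancel₀ h0
  obtain ⟨k, rfl⟩ := ho
  rw [factorial_mul_midCoeff, mul_zero]
  refine mul_eq_zero_of_right _ (Finset.prod_eq_zero (i := p - 1 - k) (by simp; omega) ?_)
  push_cast [Nat.cast_sub (show k ≤ p - 1 by omega), Nat.cast_sub (show 1 ≤ p by omega)]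
  ring

theorem neg_one_pow_add_mul_midCoeff {p j : ℕ} (hj : j ≤ p) :
    ((-1) ^ j + (-1) ^ p) * midCoeff p (p + 1 - j) = 2 * 4 ^ p * (-1) ^ p * evenChoose p (p - j) := by
  obtain ⟨k, rfl⟩ := Nat.exists_eq_add_of_le hj
  rw [Nat.add_sub_cancel_left]
  rcases Nat.even_or_odd' k with ⟨q, rfl | rfl⟩
  · have := midCoeff_odd (j + 2 * q) q
    rw [show (((j + 2 * q : ℕ) : ℤ) + 1 - j) = 2 * q + 1 by push_cast; ring, this, evenChoose,
      if_pos (by simp), Nat.mul_div_cancel_left _ (by norm_num)]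
    rw [pow_add (-1 : ℝ) j, pow_mul]
    norm_num
    ring
  · have : ¬ Even (2 * q + 1) := by simp
    rw [evenChoose, if_neg this, pow_add (-1 : ℝ) j, pow_succ, pow_mul]
    norm_num

theorem residueForm_cocycle (p : ℕ) (x : ℝ) :
    (-1) ^ p * (residueForm p (x - 1) (x + 1) + residueForm p (1 + x) (1 - x)) =
      2 * 4 ^ p * (residueForm p x 1 + residueForm p (-1) x) := by
  have h1 : residueForm p (x - 1) (x + 1) = ∑ i ∈ Finset.range (4 * p + 2 + 1),
      ((4 * p + 2).choose i : ℝ) * midCoeff p (i - 3 * p - 1) * x ^ i * (-1) ^ i := by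
    rw [show x - 1 = x + -1 by ring, show x + 1 = x - -1 by ring, residueForm_add_sub]
    refine Finset.sum_congr rfl fun i hi => ?_
    have hi : i ≤ 4 * p + 2 := by have := Finset.mem_range.1 hi; omega
    congr 1
    rw [neg_one_pow_eq_pow_mod_two, neg_one_pow_eq_pow_mod_two (n := i)]
    congr 1; omega
  have h2 : residueForm p (1 + x) (1 - x) = ∑ i ∈ Finset.range (4 * p + 2 + 1),
      ((4 * p + 2).choose i : ℝ) * midCoeff p (i - 3 * p - 1) * x ^ i * (-1) ^ p := by
    rw [residueForm_add_sub, ← Finset.sum_range_reflect]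
    refine Finset.sum_congr rfl fun i hi => ?_
    have hi : i ≤ 4 * p + 2 := by have := Finset.mem_range.1 hi; omega
    rw [show 4 * p + 2 + 1 - 1 - i = 4 * p + 2 - i by omega, Nat.choose_symm hi,
      show 4 * p + 2 - (4 * p + 2 - i) = i by omega,
      show ((4 * p + 2 - i : ℕ) : ℤ) - 3 * p - 1 = -2 * p - (i - 3 * p - 1) by
        push_cast [Nat.cast_sub hi]; ring, midCoeff_neg]
    ring
  set f : ℕ → ℝ := fun i => (-1) ^ p * (((4 * p + 2).choose i : ℝ) *
    (((-1) ^ i + (-1) ^ p) * midCoeff p (i - 3 * p - 1)) * x ^ i) with hf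
  have h3 : (-1) ^ p * (residueForm p (x - 1) (x + 1) + residueForm p (1 + x) (1 - x)) =
      ∑ i ∈ Finset.range ((p + 1 + (2 * p + 1)) + (p + 1)), f i := by
    rw [h1, h2, ← Finset.sum_add_distrib, Finset.mul_sum,
      show (p + 1 + (2 * p + 1)) + (p + 1) = 4 * p + 2 + 1 by ring]
    refine Finset.sum_congr rfl fun i _ => ?_
    simp only [hf]; ring
  have hs : ((-1 : ℝ) ^ p) * (-1) ^ p = 1 := by rw [← mul_pow]; norm_num
  have low : ∑ i ∈ Finset.range (p + 1), f i = 2 * 4 ^ p * residueForm p (-1) x := by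
    rw [residueForm_eq_sum, Finset.mul_sum]
    refine Finset.sum_congr rfl fun i hi => ?_
    have hi : i ≤ p := by have := Finset.mem_range.1 hi; omega
    have e : midCoeff p (i - 3 * p - 1) = (-1) ^ p * midCoeff p (p + 1 - i) := by
      rw [← midCoeff_neg]; congr 1; ring
    have e2 : (-1 : ℝ) ^ (4 * p + 2 - i) = (-1) ^ i := by
      rw [neg_one_pow_eq_pow_mod_two, neg_one_pow_eq_pow_mod_two (n := i)]
      congr 1; omega
    have e3 := neg_one_pow_add_mul_midCoeff hi
    have e4 : (-1 : ℝ) ^ p * evenChoose p (p - i) = (-1) ^ i * evenChoose p (p - i) := by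
      by_cases h : Even (p - i)
      · have : (-1 : ℝ) ^ p = (-1) ^ i := by
          rw [neg_one_pow_eq_pow_mod_two, neg_one_pow_eq_pow_mod_two (n := i)]
          congr 1; obtain ⟨c, hc⟩ := h; omega
        rw [this]
      · simp [evenChoose, h]
    simp only [hf]
    rw [e, e2]
    linear_combination ((4 * p + 2).choose i : ℝ) * x ^ i * (((-1) ^ p * (-1) ^ p) * e3
      + 2 * 4 ^ p * (-1) ^ p * (-1) ^ p * e4 + 2 * 4 ^ p * (-1) ^ i * evenChoose p (p - i) * hs)
  have mid : ∑ i ∈ Finset.range (2 * p + 1), f (p + 1 + i) = 0 := by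
    refine Finset.sum_eq_zero fun l hl => ?_
    have hl : l ≤ 2 * p := by have := Finset.mem_range.1 hl; omega
    simp only [hf]
    rcases Nat.even_or_odd l with h | h
    · have : (-1 : ℝ) ^ (p + 1 + l) + (-1) ^ p = 0 := by
        rw [pow_add, h.neg_one_pow, pow_succ]; ring
      rw [this]; ring
    · have hl : l < 2 * p := lt_of_le_of_ne hl (fun e => by
        rw [e] at h; exact absurd h (by simp))
      rw [show ((p + 1 + l : ℕ) : ℤ) - 3 * p - 1 = l - 2 * p by push_cast; ring,
        midCoeff_eq_zero hl h]
      ring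
  have high : ∑ i ∈ Finset.range (p + 1), f (p + 1 + (2 * p + 1) + i) =
      2 * 4 ^ p * residueForm p x 1 := by
    rw [← Finset.sum_range_reflect, residueForm_eq_sum, Finset.mul_sum]
    refine Finset.sum_congr rfl fun i hi => ?_
    have hi : i ≤ p := by have := Finset.mem_range.1 hi; omega
    have hi' : i ≤ 4 * p + 2 := by omega
    rw [show p + 1 + (2 * p + 1) + (p + 1 - 1 - i) = 4 * p + 2 - i by omega]
    simp only [hf]
    rw [Nat.choose_symm hi', show ((4 * p + 2 - i : ℕ) : ℤ) - 3 * p - 1 = p + 1 - i by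
      push_cast [Nat.cast_sub hi']; ring]
    have e2 : (-1 : ℝ) ^ (4 * p + 2 - i) = (-1) ^ i := by
      rw [neg_one_pow_eq_pow_mod_two, neg_one_pow_eq_pow_mod_two (n := i)]
      congr 1; omega
    rw [e2, neg_one_pow_add_mul_midCoeff hi]
    linear_combination 2 * 4 ^ p * evenChoose p (p - i) * ((4 * p + 2).choose i : ℝ) *
      x ^ (4 * p + 2 - i) * hs
  rw [h3, Finset.sum_range_add, Finset.sum_range_add, low, mid, high]
  ring

open Polynomial in
/-- The odd polynomial `P` with `x ^ (p + 1) * P(x) = residueForm p x 1`. -/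
noncomputable def residuePoly (p : ℕ) : ℝ[X] :=
  ∑ j ∈ Finset.range (p + 1), C (((4 * p + 2).choose j : ℝ) * evenChoose p (p - j)) *
    X ^ (3 * p + 1 - j)

open Polynomial in
/-- The polynomial `(1 - X²) ^ (p - k) (1 + X²) ^ k ((1 + X) ^ (k + 1) - (1 - X) ^ (k + 1))`. -/
noncomputable def antisymmPoly (p k : ℕ) : ℝ[X] :=
  (1 - X ^ 2) ^ (p - k) * ((1 + X ^ 2) ^ k * ((1 + X) ^ (k + 1) - (1 - X) ^ (k + 1)))

theorem pow_mul_eval_residuePoly (p : ℕ) (x : ℝ) :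
    x ^ (p + 1) * (residuePoly p).eval x = residueForm p x 1 := by
  rw [residuePoly, residueForm_eq_sum, Polynomial.eval_finsetSum, Finset.mul_sum]
  refine Finset.sum_congr rfl fun j hj => ?_
  have hj : j ≤ p := by have := Finset.mem_range.1 hj; omega
  simp only [Polynomial.eval_mul, Polynomial.eval_C, Polynomial.eval_pow, Polynomial.eval_X]
  rw [show 4 * p + 2 - j = (p + 1) + (3 * p + 1 - j) by omega, pow_add]
  ring

theorem eval_neg_residuePoly (p : ℕ) (x : ℝ) :
    (residuePoly p).eval (-x) = -(residuePoly p).eval x := by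
  rw [residuePoly, Polynomial.eval_finsetSum, Polynomial.eval_finsetSum, ← Finset.sum_neg_distrib]
  refine Finset.sum_congr rfl fun j hj => ?_
  have hj : j ≤ p := by have := Finset.mem_range.1 hj; omega
  simp only [Polynomial.eval_mul, Polynomial.eval_C, Polynomial.eval_pow, Polynomial.eval_X]
  by_cases h : Even (p - j)
  · have : Odd (3 * p + 1 - j) := by
      obtain ⟨c, hc⟩ := h
      exact ⟨p + c, by omega⟩
    rw [this.neg_pow]; ring
  · simp [evenChoose, h]

theorem eval_neg_antisymmPoly (p k : ℕ) (x : ℝ) :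
    (antisymmPoly p k).eval (-x) = -(antisymmPoly p k).eval x := by
  simp only [antisymmPoly, Polynomial.eval_mul, Polynomial.eval_pow, Polynomial.eval_sub,
    Polynomial.eval_add, Polynomial.eval_one, Polynomial.eval_X]
  ring

theorem eval_one_residuePoly (p : ℕ) : (residuePoly p).eval 1 = midCoeff p (p + 1) := by
  have h := pow_mul_eval_residuePoly p 1
  rw [one_pow, one_mul] at h
  rw [h]
  have := residueForm_add_sub p 1 0
  rw [add_zero, sub_zero] at this
  rw [this, Finset.sum_range_succ, Finset.sum_eq_zero]
  · rw [show ((4 * p + 2 : ℕ) : ℤ) - 3 * p - 1 = p + 1 by push_cast; ring]; simp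
  · intro i hi
    have hi := Finset.mem_range.1 hi
    rw [zero_pow (by omega)]; ring

open Polynomial in
theorem exists_one_sub_X_pow_dvd (p : ℕ) (P : ℝ[X]) (m : ℕ) (hm : m ≤ p + 1) :
    ∃ γ : ℕ → ℝ, (1 - X) ^ m ∣ P - ∑ k ∈ Finset.range (p + 1), C (γ k) * antisymmPoly p k := by
  induction m with
  | zero => exact ⟨0, by simp⟩
  | succ m ih =>
    obtain ⟨γ, Q, hQ⟩ := ih (by omega)
    set H : ℝ[X] := (1 + X) ^ m * ((1 + X ^ 2) ^ (p - m) *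
      ((1 + X) ^ (p - m + 1) - (1 - X) ^ (p - m + 1))) with hH
    have hG : antisymmPoly p (p - m) = (1 - X) ^ m * H := by
      rw [antisymmPoly, hH, ← mul_assoc ((1 - X) ^ m), ← mul_pow,
        show ((1 - X) * (1 + X) : ℝ[X]) = 1 - X ^ 2 by ring, show p - (p - m) = m by omega]
    have hH1 : H.eval 1 ≠ 0 := by simp [hH]
    refine ⟨fun k => γ k + if k = p - m then Q.eval 1 / H.eval 1 else 0, ?_⟩
    have hsum : ∑ k ∈ Finset.range (p + 1),
        C (γ k + if k = p - m then Q.eval 1 / H.eval 1 else 0) * antisymmPoly p k =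
        ∑ k ∈ Finset.range (p + 1), C (γ k) * antisymmPoly p k +
          C (Q.eval 1 / H.eval 1) * antisymmPoly p (p - m) := by
      simp only [map_add, add_mul, Finset.sum_add_distrib]
      congr 1
      rw [Finset.sum_eq_single (p - m)]
      · rw [if_pos rfl]
      · intro b _ hb; rw [if_neg hb]; simp
      · intro h; exact absurd (Finset.mem_range.2 (by omega)) h
    have hroot : (X - C 1) ∣ Q - C (Q.eval 1 / H.eval 1) * H := by
      rw [dvd_iff_isRoot, IsRoot]
      simp [hH1]
    have hd : (1 - X) ∣ Q - C (Q.eval 1 / H.eval 1) * H := by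
      rw [← neg_dvd]; simpa using hroot
    rw [hsum, ← sub_sub, hQ, hG, mul_left_comm, ← mul_sub, pow_succ]
    exact mul_dvd_mul_left _ hd

theorem sum_antisymm_orbit {x : ℝ} (h0 : x ≠ 0) (h1 : 1 - x ≠ 0) (h2 : x + 1 ≠ 0) (m : ℕ)
    (v : ℝ → ℝ) (hv : ∀ y, v y = (1 + y ^ 2) / (1 - y)) :
    (v x ^ m - v (-x) ^ m) + (v ((x - 1) / (x + 1)) ^ m - v (-((x - 1) / (x + 1))) ^ m) +
      (v (-1 / x) ^ m - v (-(-1 / x)) ^ m) +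
      (v ((1 + x) / (1 - x)) ^ m - v (-((1 + x) / (1 - x))) ^ m) = 0 := by
  have h3 : 1 - (x - 1) / (x + 1) ≠ 0 := by
    rw [show 1 - (x - 1) / (x + 1) = 2 / (x + 1) by field_simp; ring]; positivity
  have h4 : 1 - -1 / x ≠ 0 := by
    rw [show 1 - -1 / x = (x + 1) / x by field_simp; ring]; positivity
  have e2 : v ((x - 1) / (x + 1)) = v (-x) := by
    rw [hv, hv, div_eq_div_iff h3 (by rwa [sub_neg_eq_add, add_comm])]
    field_simp; ring
  have e4 : v (-((x - 1) / (x + 1))) = v (-1 / x) := by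
    rw [hv, hv, div_eq_div_iff _ h4]
    · field_simp; ring
    · rw [show 1 - -((x - 1) / (x + 1)) = 2 * x / (x + 1) by field_simp; ring]; positivity
  have e5 : v (-(-1 / x)) = v ((1 + x) / (1 - x)) := by
    rw [hv, hv, div_eq_div_iff]
    · field_simp; ring
    · rw [show 1 - -(-1 / x) = -((1 - x) / x) by field_simp; ring]; simp [h0, h1]
    · rw [show 1 - (1 + x) / (1 - x) = -(2 * x / (1 - x)) by field_simp; ring]; simp [h0, h1]
  have e6 : v (-((1 + x) / (1 - x))) = v x := by
    rw [hv, hv, div_eq_div_iff _ h1]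
    · field_simp; ring
    · rw [show 1 - -((1 + x) / (1 - x)) = 2 / (1 - x) by field_simp; ring]; positivity
  rw [e2, e4, e5, e6]; ring

theorem residuePoly_homogenize (p : ℕ) {a b : ℝ} (ha : a ≠ 0) (hb : b ≠ 0) :
    (1 + (a / b) ^ 2) * ((residuePoly p).eval (a / b) / (1 - (a / b) ^ 2) ^ (p + 1)) =
      (a ^ 2 + b ^ 2) * residueForm p a b / (a * b * (b ^ 2 - a ^ 2)) ^ (p + 1) := by
  have h := residueForm_smul p b (a / b) 1
  rw [mul_div_cancel₀ _ hb, mul_one, ← pow_mul_eval_residuePoly] at h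
  rw [h, show 1 + (a / b) ^ 2 = (a ^ 2 + b ^ 2) / b ^ 2 by field_simp; ring,
    show 1 - (a / b) ^ 2 = (b ^ 2 - a ^ 2) / b ^ 2 by field_simp]
  simp only [mul_pow, div_pow]
  by_cases hab : b ^ 2 - a ^ 2 = 0
  · simp [hab]
  field_simp
  ring

theorem sum_residue_orbit (p : ℕ) {x : ℝ} (h0 : x ≠ 0) (h1 : 1 - x ≠ 0) (h2 : x + 1 ≠ 0)
    (s : ℝ → ℝ) (hs : ∀ y, s y = (1 + y ^ 2) * ((residuePoly p).eval y / (1 - y ^ 2) ^ (p + 1))) :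
    s x + s ((x - 1) / (x + 1)) + s (-1 / x) + s ((1 + x) / (1 - x)) = 0 := by
  have e1 := residuePoly_homogenize p h0 one_ne_zero
  rw [div_one] at e1
  have h3 : x - 1 ≠ 0 := by rw [← neg_ne_zero, neg_sub]; exact h1
  have h4 : 1 + x ≠ 0 := by rwa [add_comm]
  have e2 := residuePoly_homogenize p h3 h2
  have e3 := residuePoly_homogenize p (neg_ne_zero.2 one_ne_zero) h0
  have e4 := residuePoly_homogenize p h4 h1
  rw [hs, hs, hs, hs, e1, e2, e3, e4]
  have hK : x * (1 - x ^ 2) ≠ 0 := by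
    rw [show x * (1 - x ^ 2) = x * ((1 - x) * (x + 1)) by ring]; positivity
  rw [show x * 1 * (1 ^ 2 - x ^ 2) = x * (1 - x ^ 2) by ring,
    show (x - 1) * (x + 1) * ((x + 1) ^ 2 - (x - 1) ^ 2) = (-4) * (x * (1 - x ^ 2)) by ring,
    show (-1) * x * (x ^ 2 - (-1) ^ 2) = x * (1 - x ^ 2) by ring,
    show (1 + x) * (1 - x) * ((1 - x) ^ 2 - (1 + x) ^ 2) = (-4) * (x * (1 - x ^ 2)) by ring,
    mul_pow (-4)]
  have h := residueForm_cocycle p x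
  have hsgn : ((-1 : ℝ) ^ p) * (-1) ^ p = 1 := by rw [← mul_pow]; norm_num
  have h4p : (-4 : ℝ) ^ (p + 1) = -4 * ((-1) ^ p * 4 ^ p) := by
    rw [pow_succ, ← mul_pow]; norm_num; ring
  have hsum : residueForm p (x - 1) (x + 1) + residueForm p (1 + x) (1 - x) =
      (-1) ^ p * (2 * 4 ^ p * (residueForm p x 1 + residueForm p (-1) x)) := by
    rw [← h, ← mul_assoc, hsgn, one_mul]
  have hKn : (x * (1 - x ^ 2)) ^ (p + 1) ≠ 0 := pow_ne_zero _ hK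
  have hs1 : (-1 : ℝ) ^ p ≠ 0 := pow_ne_zero _ (by norm_num)
  rw [h4p]
  generalize (x * (1 - x ^ 2)) ^ (p + 1) = K at hKn ⊢
  generalize (-1 : ℝ) ^ p = σ at hsum hs1 ⊢
  field_simp
  linear_combination (-2 * (1 + x ^ 2)) * hsum

open Polynomial Filter Topology in
theorem eq_zero_of_sum_orbit (e : ℝ[X]) (hodd : ∀ x, e.eval (-x) = -e.eval x)
    (h : ∀ x, x ≠ 0 → 1 - x ≠ 0 → x + 1 ≠ 0 →
      e.eval x + e.eval ((x - 1) / (x + 1)) + e.eval (-1 / x) + e.eval ((1 + x) / (1 - x)) = 0) :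
    e = 0 := by
  have i1 : Tendsto (fun x : ℝ => (x + 1)⁻¹) atTop (𝓝 0) :=
    tendsto_inv_atTop_zero.comp (tendsto_atTop_add_const_right _ _ tendsto_id)
  have i2 : Tendsto (fun x : ℝ => (x - 1)⁻¹) atTop (𝓝 0) :=
    tendsto_inv_atTop_zero.comp (tendsto_atTop_add_const_right _ (-1) tendsto_id)
  have t1 : Tendsto (fun x : ℝ => e.eval (1 - 2 * (x + 1)⁻¹)) atTop (𝓝 (e.eval (1 - 2 * 0))) :=
    (e.continuous.tendsto _).comp ((i1.const_mul 2).const_sub 1)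
  have t2 : Tendsto (fun x : ℝ => e.eval (-1 * x⁻¹)) atTop (𝓝 (e.eval (-1 * 0))) :=
    (e.continuous.tendsto _).comp (tendsto_inv_atTop_zero.const_mul (-1))
  have t3 : Tendsto (fun x : ℝ => e.eval (-1 - 2 * (x - 1)⁻¹)) atTop (𝓝 (e.eval (-1 - 2 * 0))) :=
    (e.continuous.tendsto _).comp ((i2.const_mul 2).const_sub (-1))
  have t := ((t1.add t2).add t3).neg
  have t' := t.congr' (f₂ := fun x => e.eval x) (by
    filter_upwards [eventually_gt_atTop 1] with x hx
    have a0 : x ≠ 0 := by linarith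
    have a1 : 1 - x ≠ 0 := by linarith
    have a1' : x - 1 ≠ 0 := by linarith
    have a2 : x + 1 ≠ 0 := by linarith
    rw [show 1 - 2 * (x + 1)⁻¹ = (x - 1) / (x + 1) by field_simp; ring,
      show -1 * x⁻¹ = -1 / x by field_simp,
      show -1 - 2 * (x - 1)⁻¹ = (1 + x) / (1 - x) by field_simp; ring]
    linarith [h x a0 a1 a2])
  have hdeg := (Polynomial.tendsto_nhds_iff e).1 t'
  have hC := eq_C_of_degree_le_zero hdeg.2
  have h1 := hodd 1
  rw [hC, eval_C, eval_C] at h1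
  rw [hC, show e.coeff 0 = 0 by linarith, map_zero]

open Polynomial in
theorem exists_residuePoly_eq_sum (p : ℕ) : ∃ γ : ℕ → ℝ,
    residuePoly p = ∑ k ∈ Finset.range (p + 1), C (γ k) * antisymmPoly p k := by
  obtain ⟨γ, hγ⟩ := exists_one_sub_X_pow_dvd p (residuePoly p) (p + 1) le_rfl
  refine ⟨γ, ?_⟩
  set D := residuePoly p - ∑ k ∈ Finset.range (p + 1), C (γ k) * antisymmPoly p k with hD
  have hDe (x : ℝ) : D.eval x = (residuePoly p).eval x -
      ∑ k ∈ Finset.range (p + 1), γ k * (antisymmPoly p k).eval x := by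
    simp [hD, eval_finsetSum]
  have hDodd (x : ℝ) : D.eval (-x) = -D.eval x := by
    simp only [hDe, eval_neg_residuePoly, eval_neg_antisymmPoly, mul_neg, Finset.sum_neg_distrib]
    ring
  have hDcomp : D.comp (-X) = -D := by
    refine Polynomial.funext fun x => ?_
    simp [eval_comp, hDodd]
  have hd2 : (1 + X) ^ (p + 1) ∣ D := by
    obtain ⟨Q, hQ⟩ := hγ
    refine ⟨-Q.comp (-X), ?_⟩
    rw [← neg_inj, ← hDcomp, hQ]
    simp
  have hcop : IsCoprime ((1 - X) ^ (p + 1) : ℝ[X]) ((1 + X) ^ (p + 1)) := by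
    apply IsCoprime.pow
    refine ⟨C (1 / 2), C (1 / 2), ?_⟩
    rw [← mul_add, show (1 - X + (1 + X) : ℝ[X]) = C 2 by rw [map_ofNat]; ring, ← C_mul]
    norm_num
  obtain ⟨E, hE⟩ := hcop.mul_dvd hγ hd2
  rw [← mul_pow, show ((1 - X) * (1 + X) : ℝ[X]) = 1 - X ^ 2 by ring] at hE
  have hEodd : E.comp (-X) = -E := by
    have h0 : ((1 - X ^ 2) ^ (p + 1) : ℝ[X]) ≠ 0 := fun h => by
      simpa using congrArg (eval 0) h
    apply mul_left_cancel₀ h0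
    have := hDcomp
    rw [hE] at this
    simpa using this
  have hEe (x : ℝ) : E.eval (-x) = -E.eval x := by
    simpa [eval_comp] using congrArg (eval x) hEodd
  have key : (1 + X ^ 2) * E = 0 := by
    refine eq_zero_of_sum_orbit _ (fun x => by simp [hEe]) fun x h0 h1 h2 => ?_
    have val (y : ℝ) (hy : 1 - y ≠ 0) (hy' : 1 + y ≠ 0) : ((1 + X ^ 2) * E).eval y =
        (1 + y ^ 2) * ((residuePoly p).eval y / (1 - y ^ 2) ^ (p + 1)) -
        ∑ k ∈ Finset.range (p + 1), γ k *
          (((1 + y ^ 2) / (1 - y)) ^ (k + 1) - ((1 + (-y) ^ 2) / (1 - (-y))) ^ (k + 1)) := by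
      have hy2 : 1 - y ^ 2 ≠ 0 := by
        rw [show 1 - y ^ 2 = (1 - y) * (1 + y) by ring]; positivity
      have hEy : D.eval y = (1 - y ^ 2) ^ (p + 1) * E.eval y := by rw [hE]; simp
      have hG (k : ℕ) (hk : k ∈ Finset.range (p + 1)) :
          γ k * (((1 + y ^ 2) / (1 - y)) ^ (k + 1) - ((1 + (-y) ^ 2) / (1 - (-y))) ^ (k + 1)) =
          (1 + y ^ 2) * (γ k * (antisymmPoly p k).eval y) / (1 - y ^ 2) ^ (p + 1) := by
        have hk : k ≤ p := by have := Finset.mem_range.1 hk; omega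
        obtain ⟨q, rfl⟩ := Nat.exists_eq_add_of_le hk
        simp only [antisymmPoly, eval_mul, eval_pow, eval_sub, eval_add, eval_one, eval_X,
          Nat.add_sub_cancel_left, neg_sq, sub_neg_eq_add]
        rw [show (1 - y ^ 2) ^ (k + q + 1) = (1 - y ^ 2) ^ q * ((1 - y) ^ (k + 1) * (1 + y) ^ (k + 1)) by
          rw [← mul_pow, show (1 - y) * (1 + y) = 1 - y ^ 2 by ring]; ring, div_pow, div_pow]
        field_simp
        ring
      rw [Finset.sum_congr rfl hG, ← Finset.sum_div, ← Finset.mul_sum, mul_div_assoc, ← mul_sub,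
        ← sub_div, ← hDe, hEy, mul_div_cancel_left₀ _ (pow_ne_zero _ hy2)]
      simp
    have h3 : 1 + x ≠ 0 := by rwa [add_comm]
    have b1 : 1 - (x - 1) / (x + 1) ≠ 0 := by
      rw [show 1 - (x - 1) / (x + 1) = 2 / (x + 1) by field_simp; ring]; positivity
    have b2 : 1 + (x - 1) / (x + 1) ≠ 0 := by
      rw [show 1 + (x - 1) / (x + 1) = 2 * x / (x + 1) by field_simp; ring]; positivity
    have b3 : 1 - -1 / x ≠ 0 := by
      rw [show 1 - -1 / x = (x + 1) / x by field_simp; ring]; positivity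
    have b4 : 1 + -1 / x ≠ 0 := by
      rw [show 1 + -1 / x = -((1 - x) / x) by field_simp; ring]; simp [h0, h1]
    have b5 : 1 - (1 + x) / (1 - x) ≠ 0 := by
      rw [show 1 - (1 + x) / (1 - x) = -(2 * x / (1 - x)) by field_simp; ring]; simp [h0, h1]
    have b6 : 1 + (1 + x) / (1 - x) ≠ 0 := by
      rw [show 1 + (1 + x) / (1 - x) = 2 / (1 - x) by field_simp; ring]; positivity
    rw [val x h1 h3, val _ b1 b2, val _ b3 b4, val _ b5 b6]
    have r1 := sum_residue_orbit p h0 h1 h2 _ fun y => rfl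
    have r2 : ∑ k ∈ Finset.range (p + 1), γ k * _ = 0 := Finset.sum_eq_zero fun k _ =>
      mul_eq_zero_of_right (γ k) (sum_antisymm_orbit h0 h1 h2 (k + 1) _ fun y => rfl)
    simp only [mul_add, Finset.sum_add_distrib] at r2
    linear_combination r1 - r2
  have hne : (1 + X ^ 2 : ℝ[X]) ≠ 0 := fun h => by simpa using congrArg (eval 0) h
  have hE0 : E = 0 := (mul_eq_zero.1 key).resolve_left hne
  rw [hE0, mul_zero] at hE
  exact sub_eq_zero.1 hE

open Polynomial in
theorem leading_coeff_antisymm_expansion (p : ℕ) (γ : ℕ → ℝ)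
    (h : residuePoly p = ∑ k ∈ Finset.range (p + 1), C (γ k) * antisymmPoly p k) :
    γ p * 2 ^ (2 * p + 1) = midCoeff p (p + 1) := by
  rw [← eval_one_residuePoly, h, eval_finsetSum, Finset.sum_range_succ, Finset.sum_eq_zero]
  · have : (1 + 1 : ℝ) ^ p * (1 + 1) ^ (p + 1) = 2 ^ (2 * p + 1) := by
      rw [← pow_add]; norm_num; ring
    simp [antisymmPoly, this]
  · intro k hk
    have hk := Finset.mem_range.1 hk
    simp [antisymmPoly, show p - k ≠ 0 by omega]

theorem binom_natCast (N p : ℕ) : binom N p = (N.choose p : ℝ) := by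
  have h : ∏ k ∈ Finset.range p, ((N : ℝ) - k) = (N.descFactorial p : ℝ) := by
    rw [Nat.descFactorial_eq_prod_range, Nat.cast_prod]
    rcases le_or_gt p N with h | h
    · refine Finset.prod_congr rfl fun k hk => ?_
      rw [Nat.cast_sub (by have := Finset.mem_range.1 hk; omega)]
    · rw [Finset.prod_eq_zero (Finset.mem_range.2 h) (by simp),
        Finset.prod_eq_zero (Finset.mem_range.2 h) (by simp)]
  rw [binom, Int.cast_natCast, h, Nat.descFactorial_eq_factorial_mul_choose, Nat.cast_mul,
    mul_div_cancel_left₀ _ (by positivity)]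

theorem binom_odd_reflect (i q : ℕ) :
    binom (2 * (i : ℤ) - q) (2 * i + 1) = -(q.choose (2 * i + 1) : ℝ) := by
  rw [← binom_natCast, binom, binom, ← neg_div]
  congr 1
  rw [← Finset.prod_range_reflect, ← neg_one_mul,
    ← Odd.neg_one_pow (n := 2 * i + 1) (by simp)]
  conv_rhs => enter [1]; rw [← Finset.card_range (2 * i + 1), ← Finset.prod_const]
  rw [← Finset.prod_mul_distrib]
  refine Finset.prod_congr rfl fun j hj => ?_
  have hj : j ≤ 2 * i := by have := Finset.mem_range.1 hj; omega
  rw [show 2 * i + 1 - 1 - j = 2 * i - j by omega, Nat.cast_sub hj]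
  push_cast
  ring

theorem geom_mul : (PowerSeries.mk 1 : PowerSeries ℝ) * (1 - PowerSeries.X) = 1 :=
  PowerSeries.mk_one_mul_one_sub_eq_one ℝ

/-- The power series `(1 + X²) / (1 - X)`. -/
noncomputable def orbitSeries : PowerSeries ℝ := (1 + PowerSeries.X ^ 2) * PowerSeries.mk 1

/-- The functional sending `q` to the coefficient of `X ^ (2 * i + 1)` in
`q((1 + X²) / (1 - X)) / (1 - X)`. -/
noncomputable def oddCoeff (i : ℕ) (q : Polynomial ℝ) : ℝ :=
  PowerSeries.coeff (2 * i + 1) (Polynomial.aeval orbitSeries q * PowerSeries.mk 1)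

open Polynomial in
/-- The polynomials `T` with `T j (t + 2 / t - 2) = t ^ j + (2 / t) ^ j`. -/
noncomputable def chebLike : ℕ → ℝ[X]
  | 0 => C 2
  | 1 => X + C 2
  | (k + 2) => (X + C 2) * chebLike (k + 1) - C 2 * chebLike k

theorem aeval_chebLike (j : ℕ) : Polynomial.aeval orbitSeries (chebLike j) =
    (1 - PowerSeries.X) ^ j + (2 * PowerSeries.mk 1) ^ j := by
  have hv : orbitSeries + 2 = 1 - PowerSeries.X + 2 * PowerSeries.mk 1 := by
    rw [orbitSeries]
    linear_combination (-1 - PowerSeries.X : PowerSeries ℝ) * geom_mul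
  have hC : PowerSeries.C (2 : ℝ) = 2 := map_ofNat _ 2
  induction j using chebLike.induct with
  | case1 => rw [chebLike]; simp [hC]; norm_num
  | case2 => rw [chebLike]; simpa [hC] using hv
  | case3 k ih1 ih2 =>
    rw [chebLike, map_sub, map_mul, map_mul, ih1, ih2]
    have e : Polynomial.aeval orbitSeries (Polynomial.X + Polynomial.C (2 : ℝ)) =
        1 - PowerSeries.X + 2 * PowerSeries.mk 1 := by
      rw [← hv]; simp [hC]
    have e2 : Polynomial.aeval orbitSeries (Polynomial.C (2 : ℝ)) = 2 := by simp [hC]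
    rw [e, e2]
    simp only [Nat.succ_eq_add_one]
    linear_combination (2 * (1 - PowerSeries.X) ^ k + 2 * (2 * PowerSeries.mk 1) ^ k) * geom_mul

theorem chebLike_coeff (j : ℕ) : (∀ m, j < m → (chebLike j).coeff m = 0) ∧
    (chebLike j).coeff j = if j = 0 then 2 else 1 := by
  induction j using chebLike.induct with
  | case1 =>
    refine ⟨fun m hm => ?_, ?_⟩
    · rw [chebLike, Polynomial.coeff_C, if_neg (by omega)]
    · simp [chebLike]
  | case2 =>
    refine ⟨fun m hm => ?_, ?_⟩
    · rw [chebLike, Polynomial.coeff_add, Polynomial.coeff_X, Polynomial.coeff_C]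
      rw [if_neg (by omega), if_neg (by omega), add_zero]
    · simp [chebLike]
  | case3 k ih1 ih2 =>
    have h (m : ℕ) : (chebLike (k + 2)).coeff (m + 1) = (chebLike (k + 1)).coeff m +
        2 * (chebLike (k + 1)).coeff (m + 1) - 2 * (chebLike k).coeff (m + 1) := by
      rw [chebLike, Polynomial.coeff_sub, add_mul, Polynomial.coeff_add, Polynomial.coeff_X_mul,
        Polynomial.coeff_C_mul, Polynomial.coeff_C_mul]
    refine ⟨fun m hm => ?_, ?_⟩
    · obtain ⟨m, rfl⟩ := Nat.exists_eq_add_of_lt hm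
      rw [h, ih1.1 _ (by omega), ih1.1 _ (by omega), ih2.1 _ (by omega)]; ring
    · rw [h, ih1.2, ih1.1 _ (by omega), ih2.1 _ (by omega)]; simp

theorem coeff_geom_pow (d m : ℕ) :
    PowerSeries.coeff m ((PowerSeries.mk 1 : PowerSeries ℝ) ^ (d + 1)) = ((d + m).choose d : ℝ) := by
  rw [PowerSeries.mk_one_pow_eq_mk_choose_add, PowerSeries.coeff_mk]

theorem coeff_one_sub_pow (q m : ℕ) : PowerSeries.coeff m ((1 - PowerSeries.X : PowerSeries ℝ) ^ q) =
    (-1) ^ m * (q.choose m : ℝ) := by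
  have e : (1 - PowerSeries.X : PowerSeries ℝ) ^ q = PowerSeries.evalNegHom
      (((1 + Polynomial.X) ^ q : Polynomial ℝ) : PowerSeries ℝ) := by
    simp [sub_eq_add_neg]
  rw [e, PowerSeries.evalNegHom, PowerSeries.coeff_rescale, Polynomial.coeff_coe,
    Polynomial.coeff_one_add_X_pow]

theorem oddCoeff_chebLike (i j : ℕ) : oddCoeff i (chebLike j) =
    2 ^ j * binom (2 * (i : ℤ) + j + 1) (2 * i + 1) + binom (2 * (i : ℤ) - j + 1) (2 * i + 1) := by
  have h1 : binom (2 * (i : ℤ) + j + 1) (2 * i + 1) = ((j + (2 * i + 1)).choose j : ℝ) := by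
    rw [show (2 * (i : ℤ) + j + 1) = ((j + (2 * i + 1) : ℕ) : ℤ) by push_cast; ring, binom_natCast,
      Nat.choose_symm_add]
  have h2 : PowerSeries.coeff (2 * i + 1) ((2 * PowerSeries.mk 1 : PowerSeries ℝ) ^ j *
      PowerSeries.mk 1) = 2 ^ j * ((j + (2 * i + 1)).choose j : ℝ) := by
    rw [mul_pow, mul_assoc, ← pow_succ, ← map_ofNat (PowerSeries.C (R := ℝ)) 2, ← map_pow,
      PowerSeries.coeff_C_mul, coeff_geom_pow]
  rw [oddCoeff, aeval_chebLike, add_mul, map_add, h2, h1, add_comm]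
  congr 1
  rcases j with _ | q
  · have := binom_natCast (2 * i + 1) (2 * i + 1)
    push_cast at this
    simp [this]
  · rw [pow_succ, mul_assoc, mul_comm (1 - PowerSeries.X), geom_mul, mul_one, coeff_one_sub_pow,
      show (2 * (i : ℤ) - (q + 1 : ℕ) + 1) = 2 * i - q by push_cast; ring, binom_odd_reflect,
      Odd.neg_one_pow (by simp)]
    ring

theorem oddCoeff_eq_sum (i n : ℕ) (q : Polynomial ℝ) (hq : ∀ m, n ≤ m → q.coeff m = 0) :
    oddCoeff i q = ∑ k : Fin n, oddCoeff i (Polynomial.X ^ (k : ℕ)) * q.coeff k := by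
  have h : q = ∑ k ∈ Finset.range n, Polynomial.C (q.coeff k) * Polynomial.X ^ k := by
    ext m
    simp only [Polynomial.finsetSum_coeff, Polynomial.coeff_C_mul_X_pow]
    rw [Finset.sum_ite_eq]
    split_ifs with hm
    · rfl
    · exact hq m (by simpa using hm)
  rw [← Finset.sum_range fun k => oddCoeff i (Polynomial.X ^ k) * q.coeff k]
  conv_lhs => rw [h]
  simp only [oddCoeff, map_sum, Finset.sum_mul, map_mul, Polynomial.aeval_C]
  refine Finset.sum_congr rfl fun k _ => ?_
  rw [mul_assoc, PowerSeries.algebraMap_apply, Algebra.algebraMap_self_apply,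
    PowerSeries.coeff_C_mul, mul_comm]

theorem det_oddCoeff (n : ℕ) (q : ℕ → Polynomial ℝ) (hq : ∀ j m, j < m → (q j).coeff m = 0) :
    (Matrix.of fun i j : Fin n => oddCoeff i (q j)).det =
      (Matrix.of fun i j : Fin n => oddCoeff i (Polynomial.X ^ (j : ℕ))).det *
        ∏ j ∈ Finset.range n, (q j).coeff j := by
  have h : (Matrix.of fun i j : Fin n => oddCoeff i (q j)) =
      (Matrix.of fun i j : Fin n => oddCoeff i (Polynomial.X ^ (j : ℕ))) *
        Matrix.of fun k j : Fin n => (q j).coeff k := by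
    ext i j
    rw [Matrix.mul_apply]
    exact oddCoeff_eq_sum i n (q j) fun m hm => hq j m (by omega)
  have hU : (Matrix.of fun k j : Fin n => (q j).coeff k).IsUpperTriangular :=
    fun k j hkj => hq j k hkj
  rw [h, Matrix.det_mul, Matrix.det_of_isUpperTriangular hU, Finset.prod_range]
  rfl

open Polynomial in
/-- The polynomial `∑ γ k X ^ k`, `k ≤ m`. -/
noncomputable def truncPoly (γ : ℕ → ℝ) (m : ℕ) : ℝ[X] :=
  ∑ k ∈ Finset.range (m + 1), C (γ k) * X ^ k

theorem coeff_truncPoly (γ : ℕ → ℝ) (m k : ℕ) :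
    (truncPoly γ m).coeff k = if k ≤ m then γ k else 0 := by
  rw [truncPoly]
  simp only [Polynomial.finsetSum_coeff, Polynomial.coeff_C_mul_X_pow]
  rw [Finset.sum_ite_eq]
  simp

theorem orbitSeries_antisymm {m k : ℕ} (hk : k ≤ m) :
    (orbitSeries ^ k * PowerSeries.mk 1 -
      PowerSeries.evalNegHom (orbitSeries ^ k * PowerSeries.mk 1)) *
      (1 - PowerSeries.X ^ 2) ^ (m + 1) = (antisymmPoly m k : PowerSeries ℝ) := by
  obtain ⟨q, rfl⟩ := Nat.exists_eq_add_of_le hk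
  have hg := geom_mul
  have hg' := congrArg PowerSeries.evalNegHom hg
  rw [map_mul, map_sub, map_one, PowerSeries.evalNegHom_X, sub_neg_eq_add] at hg'
  simp only [orbitSeries, map_mul, map_pow, map_add, map_one, PowerSeries.evalNegHom_X, antisymmPoly,
    Nat.add_sub_cancel_left, Polynomial.coe_mul, Polynomial.coe_pow, Polynomial.coe_add,
    Polynomial.coe_sub, Polynomial.coe_one, Polynomial.coe_X, neg_sq]
  generalize PowerSeries.evalNegHom (PowerSeries.mk 1 : PowerSeries ℝ) = b at hg' ⊢
  generalize (PowerSeries.mk 1 : PowerSeries ℝ) = a at hg ⊢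
  have ha : a ^ (k + 1) * (1 - PowerSeries.X) ^ (k + 1) = 1 := by rw [← mul_pow, hg, one_pow]
  have hb : b ^ (k + 1) * (1 + PowerSeries.X) ^ (k + 1) = 1 := by rw [← mul_pow, hg', one_pow]
  rw [show (1 - PowerSeries.X ^ 2 : PowerSeries ℝ) ^ (k + q + 1) = (1 - PowerSeries.X ^ 2) ^ q *
    ((1 - PowerSeries.X) ^ (k + 1) * (1 + PowerSeries.X) ^ (k + 1)) by
      rw [← mul_pow, show ((1 - PowerSeries.X) * (1 + PowerSeries.X) : PowerSeries ℝ) =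
        1 - PowerSeries.X ^ 2 by ring]; ring]
  rw [mul_pow, mul_pow, mul_assoc, mul_assoc _ (b ^ k), ← pow_succ, ← pow_succ]
  linear_combination (1 + PowerSeries.X ^ 2) ^ k * (1 - PowerSeries.X ^ 2) ^ q *
    ((1 + PowerSeries.X) ^ (k + 1) * ha - (1 - PowerSeries.X) ^ (k + 1) * hb)

theorem oddCoeff_truncPoly {γ : ℕ → ℝ} {m : ℕ} (i : ℕ)
    (h : residuePoly m = ∑ k ∈ Finset.range (m + 1), Polynomial.C (γ k) * antisymmPoly m k) :
    2 * oddCoeff i (truncPoly γ m) =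
      PowerSeries.coeff (2 * i + 1) ((residuePoly m : PowerSeries ℝ) *
        PowerSeries.mk (evenChoose m)) := by
  set f := Polynomial.aeval orbitSeries (truncPoly γ m) * PowerSeries.mk 1 with hf
  have hfe : f = ∑ k ∈ Finset.range (m + 1), PowerSeries.C (γ k) *
      (orbitSeries ^ k * PowerSeries.mk 1) := by
    rw [hf, truncPoly, map_sum, Finset.sum_mul]
    refine Finset.sum_congr rfl fun k _ => ?_
    rw [map_mul, Polynomial.aeval_C, map_pow, Polynomial.aeval_X, mul_assoc]
    rfl
  have h1 : (f - PowerSeries.evalNegHom f) * (1 - PowerSeries.X ^ 2) ^ (m + 1) =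
      (residuePoly m : PowerSeries ℝ) := by
    have hC (r : ℝ) : PowerSeries.evalNegHom (PowerSeries.C r) = PowerSeries.C r := by
      ext n
      rw [PowerSeries.evalNegHom, PowerSeries.coeff_rescale, PowerSeries.coeff_C]
      split_ifs with h0 <;> simp [h0]
    rw [h, hfe, map_sum, ← Finset.sum_sub_distrib, Finset.sum_mul]
    rw [← Polynomial.coeToPowerSeries.ringHom_apply, map_sum]
    refine Finset.sum_congr rfl fun k hk => ?_
    rw [Polynomial.coeToPowerSeries.ringHom_apply, Polynomial.coe_mul, Polynomial.coe_C, map_mul,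
      hC, ← mul_sub, mul_assoc,
      orbitSeries_antisymm (by have := Finset.mem_range.1 hk; omega)]
  have h2 : f - PowerSeries.evalNegHom f = (residuePoly m : PowerSeries ℝ) *
      PowerSeries.mk (evenChoose m) := by
    rw [← h1, mul_assoc, mul_comm _ (PowerSeries.mk _), mk_evenChoose_mul, mul_one]
  rw [← h2, map_sub, PowerSeries.evalNegHom, PowerSeries.coeff_rescale,
    Odd.neg_one_pow (by simp), oddCoeff]
  ring

theorem coeff_residuePoly_mul {m i : ℕ} (hi : i ≤ m) :
    PowerSeries.coeff (2 * i + 1) ((residuePoly m : PowerSeries ℝ) *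
        PowerSeries.mk (evenChoose m)) = if i = m then ((4 * m + 2).choose m : ℝ) else 0 := by
  have h : ((residuePoly m : PowerSeries ℝ) * PowerSeries.mk (evenChoose m)) =
      ∑ j ∈ Finset.range (m + 1), PowerSeries.C (((4 * m + 2).choose j : ℝ) * evenChoose m (m - j)) *
        (PowerSeries.X ^ (3 * m + 1 - j) * PowerSeries.mk (evenChoose m)) := by
    rw [residuePoly, ← Polynomial.coeToPowerSeries.ringHom_apply, map_sum, Finset.sum_mul]
    refine Finset.sum_congr rfl fun k hk => ?_
    rw [Polynomial.coeToPowerSeries.ringHom_apply, Polynomial.coe_mul, Polynomial.coe_C,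
      Polynomial.coe_pow, Polynomial.coe_X, mul_assoc]
  rw [h, map_sum, Finset.sum_range_succ, Finset.sum_eq_zero]
  · rw [PowerSeries.coeff_C_mul, PowerSeries.coeff_X_pow_mul', PowerSeries.coeff_mk]
    split_ifs with h1 h2 h2
    · rw [h2, show 2 * m + 1 - (3 * m + 1 - m) = 0 by omega]
      simp [evenChoose]
    · omega
    · omega
    · ring
  · intro j hj
    have hj := Finset.mem_range.1 hj
    rw [PowerSeries.coeff_C_mul, PowerSeries.coeff_X_pow_mul', if_neg (by omega), mul_zero]

theorem det_oddCoeff_chebLike (n : ℕ) :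
    (Matrix.of fun i j : Fin (n + 1) => oddCoeff i (chebLike j)).det =
      2 * ∏ m ∈ Finset.range (n + 1), (4 ^ m * ((4 * m + 2).choose m : ℝ) / midCoeff m (m + 1)) := by
  choose γ hγ using exists_residuePoly_eq_sum
  have hd := det_oddCoeff (n + 1) (fun j => truncPoly (γ j) j) fun j m hjm => by
    rw [coeff_truncPoly, if_neg (by omega)]
  rw [Matrix.det_of_isLowerTriangular] at hd
  swap
  · intro i j hij
    have hij : (i : ℕ) < j := hij
    have := oddCoeff_truncPoly i (hγ j)
    rw [coeff_residuePoly_mul hij.le, if_neg hij.ne] at this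
    simpa using this
  have hdiag (m : ℕ) : oddCoeff m (truncPoly (γ m) m) = ((4 * m + 2).choose m : ℝ) / 2 := by
    have := oddCoeff_truncPoly m (hγ m)
    rw [coeff_residuePoly_mul le_rfl, if_pos rfl] at this
    linarith
  simp only [Matrix.of_apply, hdiag, coeff_truncPoly, le_refl, if_true] at hd
  rw [← Finset.prod_range fun m => ((4 * m + 2).choose m : ℝ) / 2] at hd
  have hlead (m : ℕ) : γ m m = midCoeff m (m + 1) / 2 ^ (2 * m + 1) := by
    rw [eq_div_iff (by positivity)]; exact leading_coeff_antisymm_expansion m _ (hγ m)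
  have hpos (m : ℕ) : midCoeff m (m + 1) ≠ 0 := by
    intro h0
    have := factorial_mul_midCoeff m (m + 1)
    rw [h0, mul_zero] at this
    have h1 : (0 : ℝ) < 2 ^ m * ∏ j ∈ Finset.range m, (((m + 1 : ℤ) : ℝ) + 1 + 2 * (j : ℝ)) := by
      push_cast
      exact mul_pos (by positivity) (Finset.prod_pos fun j _ => by positivity)
    linarith
  have hγ0 : ∏ m ∈ Finset.range (n + 1), γ m m ≠ 0 := by
    refine Finset.prod_ne_zero_iff.2 fun m _ => ?_
    rw [hlead]
    exact div_ne_zero (hpos m) (by positivity)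
  have hT : ∏ m ∈ Finset.range (n + 1), (chebLike m).coeff m = 2 := by
    rw [Finset.prod_range_succ']
    simp [chebLike_coeff]
  rw [det_oddCoeff (n + 1) chebLike fun j => (chebLike_coeff j).1, hT, mul_comm]
  congr 1
  rw [eq_comm, ← eq_div_iff hγ0, ← Finset.prod_div_distrib] at hd
  rw [hd]
  refine Finset.prod_congr rfl fun m _ => ?_
  rw [hlead]
  have := hpos m
  rw [show (4 : ℝ) = 2 * 2 by norm_num, mul_pow]
  field_simp
  ring

theorem Gamma_add_nat {s : ℝ} (hs : 0 < s) (k : ℕ) :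
    Real.Gamma (s + k) = Real.Gamma s * ∏ j ∈ Finset.range k, (s + j) := by
  induction k with
  | zero => simp
  | succ k ih =>
    rw [Nat.cast_succ, ← add_assoc, Real.Gamma_add_one (by positivity), ih, Finset.prod_range_succ]
    ring

theorem factorial_add_two_mul (a k : ℕ) : ((a + 2 * k).factorial : ℝ) = a.factorial *
    ((∏ j ∈ Finset.range k, ((a : ℝ) + 1 + 2 * j)) * ∏ j ∈ Finset.range k, ((a : ℝ) + 2 + 2 * j)) := by
  induction k with
  | zero => simp
  | succ k ih =>
    rw [show a + 2 * (k + 1) = a + 2 * k + 1 + 1 by ring, Nat.factorial_succ, Nat.factorial_succ,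
      Finset.prod_range_succ, Finset.prod_range_succ]
    push_cast
    rw [ih]
    ring

theorem choose_div_midCoeff_eq_Gamma (m : ℕ) (i : ℝ) (hi : i = m + 1) :
    ((4 * m + 2).choose m : ℝ) / midCoeff m (m + 1) =
      Real.Gamma i * Real.Gamma (4 * i - 1) * Real.Gamma ((3 * i - 2) / 2)
        / (Real.Gamma (3 * i) * Real.Gamma (3 * i - 2) * Real.Gamma (i / 2)) := by
  have g1 : Real.Gamma i = m.factorial := by rw [hi, Real.Gamma_nat_eq_factorial]
  have g2 : Real.Gamma (4 * i - 1) = (4 * m + 2).factorial := by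
    rw [← Real.Gamma_nat_eq_factorial, hi]; congr 1; push_cast; ring
  have g3 : Real.Gamma (3 * i) = (3 * m + 2).factorial := by
    rw [← Real.Gamma_nat_eq_factorial, hi]; congr 1; push_cast; ring
  have g4 : Real.Gamma (3 * i - 2) = (3 * m).factorial := by
    rw [← Real.Gamma_nat_eq_factorial, hi]; congr 1; push_cast; ring
  have hi2 : 0 < i / 2 := by rw [hi]; positivity
  have g5 := Gamma_add_nat hi2 m
  rw [show i / 2 + m = (3 * i - 2) / 2 by rw [hi]; ring] at g5
  have g6 := (Real.Gamma_pos_of_pos hi2).ne'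
  have c1 : ((4 * m + 2).choose m : ℝ) = (4 * m + 2).factorial /
      (m.factorial * (3 * m + 2).factorial) := by
    rw [Nat.cast_choose ℝ (by omega), show 4 * m + 2 - m = 3 * m + 2 by omega]
  have c2 := factorial_add_two_mul m m
  rw [show m + 2 * m = 3 * m by ring] at c2
  have c3 := factorial_mul_midCoeff m (m + 1)
  have c4 : ∏ j ∈ Finset.range m, (((m + 1 : ℤ) : ℝ) + 1 + 2 * (j : ℝ)) =
      ∏ j ∈ Finset.range m, ((m : ℝ) + 2 + 2 * j) :=
    Finset.prod_congr rfl fun j _ => by push_cast; ring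
  have c5 : 2 ^ m * ∏ j ∈ Finset.range m, (i / 2 + j) =
      ∏ j ∈ Finset.range m, ((m : ℝ) + 1 + 2 * j) := by
    conv_lhs => enter [1]; rw [← Finset.card_range m, ← Finset.prod_const]
    rw [← Finset.prod_mul_distrib]
    refine Finset.prod_congr rfl fun j _ => ?_
    rw [hi]; ring
  have p1 : 0 < ∏ j ∈ Finset.range m, ((m : ℝ) + 2 + 2 * j) :=
    Finset.prod_pos fun j _ => by positivity
  have p2 : 0 < ∏ j ∈ Finset.range m, (i / 2 + j) := Finset.prod_pos fun j _ => by positivity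
  have f1 : (0 : ℝ) < m.factorial := by positivity
  have f2 : (0 : ℝ) < (3 * m + 2).factorial := by positivity
  rw [c4] at c3
  have c6 : midCoeff m (m + 1) = 2 ^ m * (∏ j ∈ Finset.range m, ((m : ℝ) + 2 + 2 * j)) /
      m.factorial := by
    rw [eq_div_iff f1.ne', mul_comm, c3]
  rw [g1, g2, g3, g4, g5, c1, c6, c2, ← c5]
  generalize ∏ j ∈ Finset.range m, (i / 2 + (j : ℝ)) = A at p2 ⊢
  generalize ∏ j ∈ Finset.range m, ((m : ℝ) + 2 + 2 * j) = B at p1 ⊢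
  field_simp

theorem two_pow_eq_prod_four_pow (n : ℕ) :
    (2 : ℝ) ^ (n * (n - 1)) = ∏ m ∈ Finset.range n, 4 ^ m := by
  rw [Finset.prod_pow_eq_pow_sum, ← Finset.sum_range_id_mul_two, mul_comm, pow_mul]
  norm_num

theorem stmt_3 (n : ℕ) (hn : 0 < n) :
    (Matrix.of fun i j : Fin n =>
        (2 : ℝ) ^ (j : ℕ) * binom (2 * ((i : ℕ) : ℤ) + ((j : ℕ) : ℤ) + 1) (2 * (i : ℕ) + 1)
          + binom (2 * ((i : ℕ) : ℤ) - ((j : ℕ) : ℤ) + 1) (2 * (i : ℕ) + 1)).det =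
      2 * 2 ^ (n * (n - 1)) * ∏ i ∈ Finset.Icc 1 n,
          Real.Gamma (i : ℝ) * Real.Gamma (4 * (i : ℝ) - 1) * Real.Gamma ((3 * (i : ℝ) - 2) / 2)
            / (Real.Gamma (3 * (i : ℝ)) * Real.Gamma (3 * (i : ℝ) - 2) * Real.Gamma ((i : ℝ) / 2)) := by
  obtain ⟨n, rfl⟩ := Nat.exists_eq_add_of_lt hn
  rw [zero_add]
  simp only [← oddCoeff_chebLike]
  rw [det_oddCoeff_chebLike, two_pow_eq_prod_four_pow, mul_assoc,
    ← Finset.Ico_succ_right_eq_Icc, Nat.succ_eq_succ, Finset.prod_Ico_eq_prod_range,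
    Nat.succ_eq_add_one, Nat.add_sub_cancel, ← Finset.prod_mul_distrib]
  congr 1
  refine Finset.prod_congr rfl fun m _ => ?_
  rw [mul_div_assoc, choose_div_midCoeff_eq_Gamma m ((1 + m : ℕ) : ℝ) (by push_cast; ring)]
end

section
/- For every positive integer n, the determinant of the n×n matrix whose (i,j)-entry (0 ≤ i,j ≤ n−1) is 4^{j}·binom(2i+j+1, 2i+1) + binom(2i−j+1, 2i+1) equals 2·3^{n(n−1)/2} times the product over i = 1 to n of Γ(3i−1)·Γ((i+1)/2) / (Γ(2i)·Γ((3i−1)/2)). -/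
open scoped BigOperators

namespace AztecDet

open PowerSeries

theorem C_ofNat (m : ℕ) [m.AtLeastTwo] : (C (OfNat.ofNat m : ℝ) : ℝ⟦X⟧) = OfNat.ofNat m :=
  map_ofNat C m

theorem derivative_ofNat (m : ℕ) [m.AtLeastTwo] : d⁄dX ℝ (OfNat.ofNat m : ℝ⟦X⟧) = 0 := by
  rw [← C_ofNat, derivative_C]

theorem constantCoeff_ofNat (m : ℕ) [m.AtLeastTwo] :
    constantCoeff (OfNat.ofNat m : ℝ⟦X⟧) = OfNat.ofNat m :=
  map_ofNat constantCoeff m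

theorem ofNat_ne_zero (m : ℕ) [m.AtLeastTwo] : (OfNat.ofNat m : ℝ⟦X⟧) ≠ 0 := fun h => by
  have := congrArg constantCoeff h
  rw [constantCoeff_ofNat, map_zero] at this
  exact OfNat.ofNat_ne_zero m this

/-- The partial numerators of the continued fraction of `tanh (θ / 3)` in powers of `tanh θ`. -/
noncomputable def pnum (n : ℕ) : ℝ := ((n : ℝ) ^ 2 - 1 / 9) / (4 * (n : ℝ) ^ 2 - 1)

theorem four_mul_sq_sub_one_ne_zero (n : ℕ) : 4 * (n : ℝ) ^ 2 - 1 ≠ 0 := by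
  intro h
  have h2 : (4 * n ^ 2 : ℕ) = 1 := by exact_mod_cast sub_eq_zero.mp h
  omega

theorem pnum_ne_zero (n : ℕ) : pnum n ≠ 0 := by
  refine div_ne_zero (fun h => ?_) (four_mul_sq_sub_one_ne_zero n)
  have h2 : (9 * n ^ 2 : ℕ) = 1 := by
    have : (9 * (n : ℝ) ^ 2) = 1 := by linarith
    exact_mod_cast this
  omega

theorem pnum_succ (n : ℕ) :
    (2 * (n : ℝ) + 3) * pnum (n + 1) = 1 + (2 * (n : ℝ) - 1) * pnum n := by
  have h1 := four_mul_sq_sub_one_ne_zero n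
  have h2 := four_mul_sq_sub_one_ne_zero (n + 1)
  have e1 : pnum n * (4 * (n : ℝ) ^ 2 - 1) = (n : ℝ) ^ 2 - 1 / 9 := div_mul_cancel₀ _ h1
  have e2 : pnum (n + 1) * (4 * ((n + 1 : ℕ) : ℝ) ^ 2 - 1) = ((n + 1 : ℕ) : ℝ) ^ 2 - 1 / 9 :=
    div_mul_cancel₀ _ h2
  apply mul_left_cancel₀ (mul_ne_zero h1 h2)
  push_cast at e2 ⊢
  linear_combination (2 * (n : ℝ) + 3) * (4 * (n : ℝ) ^ 2 - 1) * e2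
    - (2 * (n : ℝ) - 1) * (4 * ((n : ℝ) + 1) ^ 2 - 1) * e1

/-- The triple-angle series `X (9 - X²) / (9 (1 - X²))`. -/
noncomputable def tripleAngle : ℝ⟦X⟧ := X * (9 - X ^ 2) * (9 * (1 - X ^ 2))⁻¹

theorem tripleAngle_spec : 9 * (1 - X ^ 2) * tripleAngle = X * (9 - X ^ 2) := by
  have h : (9 * (1 - X ^ 2) : ℝ⟦X⟧) * (9 * (1 - X ^ 2))⁻¹ = 1 := by
    apply PowerSeries.mul_inv_cancel
    simp [show constantCoeff (9 : ℝ⟦X⟧) = 9 from constantCoeff_ofNat 9]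
  unfold tripleAngle
  linear_combination X * (9 - X ^ 2) * h

theorem one_sub_X_sq_ne_zero : (1 - X ^ 2 : ℝ⟦X⟧) ≠ 0 := by
  intro h
  simpa using congrArg constantCoeff h

theorem derivative_tripleAngle :
    (3 + X ^ 2) * d⁄dX ℝ tripleAngle = 3 + 9 * tripleAngle ^ 2 := by
  have h := tripleAngle_spec
  have h' := congrArg (d⁄dX ℝ) h
  simp only [Derivation.leibniz, map_sub, Derivation.leibniz_pow, derivative_X,
    show d⁄dX ℝ (9 : ℝ⟦X⟧) = 0 from derivative_ofNat 9,
    Derivation.map_one_eq_zero, smul_eq_mul, nsmul_eq_mul] at h'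
  norm_num at h'
  have hne : (9 * (1 - X ^ 2) ^ 2 : ℝ⟦X⟧) ≠ 0 :=
    mul_ne_zero (ofNat_ne_zero 9) (pow_ne_zero _ one_sub_X_sq_ne_zero)
  apply mul_left_cancel₀ hne
  linear_combination (3 + X ^ 2) * (1 - X ^ 2) * h'
    + (2 * X * (3 + X ^ 2) - 9 * (1 - X ^ 2) * tripleAngle - X * (9 - X ^ 2)) * h

/-- The denominators-cleared remainders of the continued fraction of `X` in terms of
`tripleAngle`. -/
noncomputable def remainder : ℕ → ℝ⟦X⟧
  | 0 => X
  | 1 => X - tripleAngle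
  | n + 2 => remainder (n + 1) + 3 * C (pnum (n + 1)) * tripleAngle ^ 2 * remainder n

/-- The lowering and raising first-order differential relations between remainders. -/
theorem remainder_ladder (n : ℕ) :
    ((3 + X ^ 2) * d⁄dX ℝ (remainder (n + 1)) - X * remainder (n + 1)
        - 9 * ((n : ℝ⟦X⟧) + 1) * tripleAngle * remainder (n + 1)
      = -9 * (2 * (n : ℝ⟦X⟧) + 3) * C (pnum (n + 1)) * tripleAngle * remainder n) ∧
    (tripleAngle * ((3 + X ^ 2) * d⁄dX ℝ (remainder n) - X * remainder n)
      = 9 * (n : ℝ⟦X⟧) * tripleAngle ^ 2 * remainder n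
        + 3 * (2 * (n : ℝ⟦X⟧) + 1) * (remainder n - remainder (n + 1))) := by
  induction n with
  | zero =>
    have h := derivative_tripleAngle
    have hp : (C (pnum 1) : ℝ⟦X⟧) * 27 = 8 := by
      have : pnum 1 * 27 = 8 := by norm_num [pnum]
      have := congrArg (C (R := ℝ)) this
      simpa [show (C 27 : ℝ⟦X⟧) = 27 from C_ofNat 27,
        show (C 8 : ℝ⟦X⟧) = 8 from C_ofNat 8] using this
    constructor
    · simp only [remainder, map_sub, derivative_X, zero_add, Nat.cast_zero]
      linear_combination -h + tripleAngle * X * hp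
    · simp only [remainder, derivative_X, Nat.cast_zero]
      ring
  | succ n ih =>
    obtain ⟨hL, hR⟩ := ih
    have h := derivative_tripleAngle
    have hp : (2 * ((n : ℝ⟦X⟧) + 1) + 3) * C (pnum (n + 2))
        = 1 + (2 * ((n : ℝ⟦X⟧) + 1) - 1) * C (pnum (n + 1)) := by
      have := congrArg (C (R := ℝ)) (pnum_succ (n + 1))
      simpa [show (C 2 : ℝ⟦X⟧) = 2 from C_ofNat 2,
        show (C 3 : ℝ⟦X⟧) = 3 from C_ofNat 3] using this
    have hT : remainder (n + 2) = remainder (n + 1)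
        + 3 * C (pnum (n + 1)) * tripleAngle ^ 2 * remainder n := rfl
    have hT' := congrArg (d⁄dX ℝ) hT
    simp only [Derivation.leibniz, map_add, Derivation.leibniz_pow, derivative_C,
      show d⁄dX ℝ (3 : ℝ⟦X⟧) = 0 from derivative_ofNat 3,
      smul_eq_mul, nsmul_eq_mul] at hT'
    norm_num at hT'
    have hR' : tripleAngle * ((3 + X ^ 2) * d⁄dX ℝ (remainder (n + 1)) - X * remainder (n + 1))
      = 9 * ((n : ℝ⟦X⟧) + 1) * tripleAngle ^ 2 * remainder (n + 1)
        + 3 * (2 * ((n : ℝ⟦X⟧) + 1) + 1) * (remainder (n + 1) - remainder (n + 2)) := by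
      rw [hT]
      linear_combination tripleAngle * hL
    refine ⟨?_, by push_cast; exact hR'⟩
    push_cast
    rw [show n + 1 + 1 = n + 2 from rfl, hT', hT]
    linear_combination hL + 3 * C (pnum (n + 1)) * tripleAngle * hR
      + 6 * C (pnum (n + 1)) * tripleAngle * remainder n * h
      + 9 * tripleAngle * remainder (n + 1) * hp

theorem tripleAngle_eq_X_mul :
    ∃ W : ℝ⟦X⟧, tripleAngle = X * W ∧ constantCoeff W = 1 := by
  refine ⟨(9 - X ^ 2) * (9 * (1 - X ^ 2))⁻¹, mul_assoc _ _ _, ?_⟩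
  simp [PowerSeries.constantCoeff_inv, show constantCoeff (9 : ℝ⟦X⟧) = 9 from constantCoeff_ofNat 9]

theorem constantCoeff_remainder : ∀ n, constantCoeff (remainder n) = 0
  | 0 => by simp [remainder]
  | 1 => by
    obtain ⟨W, hW, -⟩ := tripleAngle_eq_X_mul
    simp [remainder, hW]
  | n + 2 => by
    simp [remainder, constantCoeff_remainder (n + 1), constantCoeff_remainder n]

/-- The leading coefficient of `remainder n`. -/
noncomputable def leadRemainder (n : ℕ) : ℝ := ∏ k ∈ Finset.range n, (-3 * pnum (k + 1))

theorem X_pow_succ_dvd_of_derivative {f : ℝ⟦X⟧} {m : ℕ} (h0 : constantCoeff f = 0)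
    (h : X ^ m ∣ d⁄dX ℝ f) : X ^ (m + 1) ∣ f := by
  rw [X_pow_dvd_iff] at h ⊢
  intro k hk
  rcases k with - | k
  · simpa using h0
  · have := h k (by omega)
    rw [coeff_derivative] at this
    exact (mul_eq_zero.mp this).resolve_right (by positivity)

theorem remainder_eq_X_pow_mul (n : ℕ) :
    ∃ W : ℝ⟦X⟧, remainder n = X ^ (2 * n + 1) * W ∧ constantCoeff W = leadRemainder n := by
  induction n with
  | zero => exact ⟨1, by simp [remainder], by simp [leadRemainder]⟩
  | succ n ih =>
    obtain ⟨W, hW, hW0⟩ := ih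
    obtain ⟨V, hV, hV0⟩ := tripleAngle_eq_X_mul
    have hL := (remainder_ladder n).1
    have hunit : IsUnit (3 + X ^ 2 : ℝ⟦X⟧) := by
      rw [isUnit_iff_constantCoeff]
      simp [show constantCoeff (3 : ℝ⟦X⟧) = 3 from constantCoeff_ofNat 3]
    have hdvd : ∀ m ≤ 2 * n + 3, X ^ m ∣ remainder (n + 1) := by
      intro m
      induction m with
      | zero => simp
      | succ m ihm =>
        intro hm
        apply X_pow_succ_dvd_of_derivative (constantCoeff_remainder _)
        rw [← hunit.dvd_mul_left]
        have h1 : X ^ m ∣ remainder n * tripleAngle := by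
          refine (pow_dvd_pow X (show m ≤ 2 * n + 1 + 1 by omega)).trans ?_
          rw [hW, hV]
          exact ⟨W * V, by ring⟩
        have h2 : (3 + X ^ 2) * d⁄dX ℝ (remainder (n + 1))
            = remainder (n + 1) * (X + 9 * ((n : ℝ⟦X⟧) + 1) * tripleAngle)
              + remainder n * tripleAngle * (-9 * (2 * (n : ℝ⟦X⟧) + 3) * C (pnum (n + 1))) := by
          linear_combination hL
        rw [h2]
        exact dvd_add (Dvd.dvd.mul_right (ihm (by omega)) _) (Dvd.dvd.mul_right h1 _)
    obtain ⟨R, hR⟩ := hdvd _ le_rfl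
    refine ⟨R, hR, ?_⟩
    have hR' := congrArg (d⁄dX ℝ) hR
    simp only [Derivation.leibniz, Derivation.leibniz_pow, derivative_X, smul_eq_mul,
      nsmul_eq_mul, mul_one] at hR'
    rw [show 2 * n + 3 - 1 = 2 * n + 2 from rfl] at hR'
    rw [hR', hR, hW, hV] at hL
    have key : (3 + X ^ 2) * (X * d⁄dX ℝ R + ((2 * n + 3 : ℕ) : ℝ⟦X⟧) * R) - X ^ 2 * R
        - 9 * ((n : ℝ⟦X⟧) + 1) * X ^ 2 * V * R
        = -9 * (2 * (n : ℝ⟦X⟧) + 3) * C (pnum (n + 1)) * V * W := by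
      apply mul_left_cancel₀ (pow_ne_zero (2 * n + 2) (X_ne_zero (R := ℝ)))
      linear_combination hL
    have := congrArg constantCoeff key
    simp only [map_sub, map_mul, map_add, map_pow, constantCoeff_X, map_natCast, hV0, hW0,
      map_neg, constantCoeff_C, show constantCoeff (3 : ℝ⟦X⟧) = 3 from constantCoeff_ofNat 3,
      show constantCoeff (2 : ℝ⟦X⟧) = 2 from constantCoeff_ofNat 2,
      show constantCoeff (9 : ℝ⟦X⟧) = 9 from constantCoeff_ofNat 9] at this
    push_cast at this
    rw [leadRemainder, Finset.prod_range_succ, ← leadRemainder]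
    have hne : (2 * (n : ℝ) + 3) ≠ 0 := by positivity
    apply mul_left_cancel₀ hne
    linear_combination this / 3

/-- The difference `f(X) - f(-X)`, twice the odd part of `f`. -/
noncomputable def oddDiff (f : ℝ⟦X⟧) : ℝ⟦X⟧ := f - evalNegHom f

/-- The geometric series `(1 - X)⁻¹`. -/
noncomputable def geom : ℝ⟦X⟧ := (1 - X)⁻¹

theorem one_sub_mul_geom : (1 - X) * geom = 1 :=
  PowerSeries.mul_inv_cancel _ (by simp)

theorem C_half : (C (1 / 2) : ℝ⟦X⟧) * 2 = 1 := by
  rw [← C_ofNat, ← map_mul]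
  simp

/-- The series `y + y⁻¹` with `y = 2 / (1 - X)`. -/
noncomputable def joukowski : ℝ⟦X⟧ := 2 * geom + C (1 / 2) * (1 - X)

theorem joukowski_spec : 2 * (1 - X) * joukowski = 4 + (1 - X) ^ 2 := by
  unfold joukowski
  linear_combination 4 * one_sub_mul_geom + (1 - X) ^ 2 * C_half

/-- The series `P(y + y⁻¹) / (1 - X)` with `y = 2 / (1 - X)`. -/
noncomputable def toSeries (P : Polynomial ℝ) : ℝ⟦X⟧ := Polynomial.aeval joukowski P * geom

theorem evalNegHom_C (a : ℝ) : evalNegHom (C a : ℝ⟦X⟧) = C a := by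
  ext n
  rw [evalNegHom, coeff_rescale, coeff_C]
  split_ifs with h <;> simp [h]

theorem one_add_mul_evalNegHom_geom : (1 + X) * evalNegHom geom = 1 := by
  simpa using congrArg evalNegHom one_sub_mul_geom

/-- Every polynomial has a companion whose odd part is multiplied by `tripleAngle ^ 2`. -/
theorem exists_mul_tripleAngle_sq (P : Polynomial ℝ) (m : ℕ) (hP : P.natDegree ≤ m) :
    ∃ Q : Polynomial ℝ, Q.natDegree ≤ m + 2 ∧ Q.coeff (m + 2) = 4 / 81 * P.coeff m ∧
      oddDiff (toSeries Q) = tripleAngle ^ 2 * oddDiff (toSeries P) := by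
  set p := P.eval 2 with hp
  set A : Polynomial ℝ := Polynomial.C (1 / 81) *
    ((2 * Polynomial.X - 5) ^ 2 * (Polynomial.X + 2)) with hA
  set B : Polynomial ℝ := Polynomial.C (4 / 81 * p) * (Polynomial.X - 1) ^ 2 with hB
  set S := A * P - B with hS
  have hAdeg : A.natDegree ≤ 3 := by rw [hA]; compute_degree
  have hBdeg : B.natDegree ≤ 2 := by rw [hB]; compute_degree
  have hA3 : A.coeff 3 = 4 / 81 := by
    rw [hA, Polynomial.coeff_C_mul]
    have : ((2 * Polynomial.X - 5) ^ 2 * (Polynomial.X + 2) : Polynomial ℝ).coeff 3 = 4 := by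
      compute_degree!
    rw [this]; norm_num
  have hSdeg : S.natDegree ≤ m + 3 := by
    refine (Polynomial.natDegree_sub_le _ _).trans (max_le ?_ (by omega))
    exact Polynomial.natDegree_mul_le.trans (by omega)
  have hStop : S.coeff (m + 3) = 4 / 81 * P.coeff m := by
    rw [hS, Polynomial.coeff_sub, mul_comm A P, Polynomial.coeff_mul_add_eq_of_natDegree_le hP hAdeg, hA3,
      Polynomial.coeff_eq_zero_of_natDegree_lt (show B.natDegree < m + 3 by omega)]
    ring
  have hroot : S.IsRoot 2 := by
    simp only [hS, hA, hB, Polynomial.IsRoot.def, Polynomial.eval_sub, Polynomial.eval_mul,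
      Polynomial.eval_C, Polynomial.eval_pow, Polynomial.eval_add, Polynomial.eval_X,
      Polynomial.eval_ofNat, Polynomial.eval_one, ← hp]
    ring
  have hdiv := Polynomial.mul_divByMonic_eq_iff_isRoot.mpr hroot
  set Q := S /ₘ (Polynomial.X - Polynomial.C 2) with hQ
  have hQdeg : Q.natDegree ≤ m + 2 := by
    rw [hQ, Polynomial.natDegree_divByMonic _ (Polynomial.monic_X_sub_C _),
      Polynomial.natDegree_X_sub_C]
    omega
  refine ⟨Q, hQdeg, ?_, ?_⟩
  · rw [← hStop, ← hdiv, sub_mul, Polynomial.coeff_sub, Polynomial.coeff_X_mul,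
      Polynomial.coeff_C_mul,
      Polynomial.coeff_eq_zero_of_natDegree_lt (show Q.natDegree < m + 3 by omega)]
    ring
  have hw := joukowski_spec
  have hg := one_sub_mul_geom
  have hser := congrArg (Polynomial.aeval joukowski) hdiv
  simp only [hS, hA, hB, map_mul, map_sub, map_add, map_pow, Polynomial.aeval_X,
    Polynomial.aeval_C, map_ofNat, map_one] at hser
  have h81 : algebraMap ℝ ℝ⟦X⟧ (1 / 81) * 81 = 1 := by
    rw [← map_ofNat (algebraMap ℝ ℝ⟦X⟧) 81, ← map_mul]
    norm_num
  have h481 : algebraMap ℝ ℝ⟦X⟧ (4 / 81) * 81 = 4 := by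
    rw [← map_ofNat (algebraMap ℝ ℝ⟦X⟧) 81, ← map_ofNat (algebraMap ℝ ℝ⟦X⟧) 4, ← map_mul]
    norm_num
  have hc : algebraMap ℝ ℝ⟦X⟧ p = C p := rfl
  rw [hc] at hser
  have f1 : 2 * (1 - X) * (joukowski - 2) = (1 + X) ^ 2 := by linear_combination hw
  have f2 : (1 - X) * (2 * joukowski - 5) = X * (3 + X) := by linear_combination hw
  have f3 : 2 * (1 - X) * (joukowski + 2) = (3 - X) ^ 2 := by linear_combination hw
  have f4 : 2 * (1 - X) * (joukowski - 1) = 3 + X ^ 2 := by linear_combination hw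
  have e2 : 2 * (1 - X) ^ 3 * ((2 * joukowski - 5) ^ 2 * (joukowski + 2))
      = X ^ 2 * (9 - X ^ 2) ^ 2 := by
    calc _ = ((1 - X) * (2 * joukowski - 5)) ^ 2 * (2 * (1 - X) * (joukowski + 2)) := by ring
      _ = _ := by rw [f2, f3]; ring
  have e3 : 4 * (1 - X) ^ 2 * (joukowski - 1) ^ 2 = (3 + X ^ 2) ^ 2 := by
    rw [← f4]; ring
  have main : 81 * (1 - X ^ 2) ^ 2 * toSeries Q
      = X ^ 2 * (9 - X ^ 2) ^ 2 * toSeries P - 2 * (3 + X ^ 2) ^ 2 * C p := by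
    unfold toSeries
    set q := Polynomial.aeval joukowski Q
    set r := Polynomial.aeval joukowski P
    linear_combination 2 * 81 * (1 - X) ^ 3 * geom * hser - 81 * (1 - X) ^ 2 * q * geom * f1
      + r * geom * e2 - 2 * (1 - X) * geom * C p * e3
      - 2 * (3 + X ^ 2) ^ 2 * C p * hg
      + 2 * (1 - X) ^ 3 * geom * ((2 * joukowski - 5) ^ 2 * (joukowski + 2)) * r * h81
      - 2 * (1 - X) ^ 3 * geom * C p * (joukowski - 1) ^ 2 * h481
  have main' := congrArg evalNegHom main
  simp only [map_mul, map_sub, map_pow, map_one, map_ofNat, evalNegHom_X, map_add,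
    evalNegHom_C] at main'
  have hne : (81 * (1 - X ^ 2) ^ 2 : ℝ⟦X⟧) ≠ 0 :=
    mul_ne_zero (ofNat_ne_zero 81) (pow_ne_zero _ one_sub_X_sq_ne_zero)
  apply mul_left_cancel₀ hne
  unfold oddDiff
  have hU := tripleAngle_spec
  linear_combination main - main'
    - (9 * (1 - X ^ 2) * tripleAngle + X * (9 - X ^ 2))
      * (toSeries P - evalNegHom (toSeries P)) * hU

/-- The leading coefficients of the polynomials triangularizing the determinant. -/
noncomputable def leadPoly : ℕ → ℝ
  | 0 => 1
  | 1 => -2 / 9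
  | n + 2 => 4 / 27 * pnum (n + 1) * leadPoly n

theorem leadPoly_ne_zero : ∀ n, leadPoly n ≠ 0
  | 0 => by norm_num [leadPoly]
  | 1 => by norm_num [leadPoly]
  | n + 2 => by
    have := leadPoly_ne_zero n
    have := pnum_ne_zero (n + 1)
    unfold leadPoly
    positivity

theorem toSeries_add (P Q : Polynomial ℝ) : toSeries (P + Q) = toSeries P + toSeries Q := by
  simp [toSeries, add_mul]

theorem toSeries_C_mul (a : ℝ) (P : Polynomial ℝ) :
    toSeries (Polynomial.C a * P) = C a * toSeries P := by
  rw [toSeries, map_mul, Polynomial.aeval_C, mul_assoc]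
  rfl

theorem oddDiff_add (f g : ℝ⟦X⟧) : oddDiff (f + g) = oddDiff f + oddDiff g := by
  simp only [oddDiff, map_add]; ring

theorem oddDiff_C_mul (a : ℝ) (f : ℝ⟦X⟧) : oddDiff (C a * f) = C a * oddDiff f := by
  simp only [oddDiff, map_mul, evalNegHom_C]; ring

theorem oddDiff_toSeries_one : (1 - X ^ 2) * oddDiff (toSeries 1) = 2 * X := by
  simp only [toSeries, map_one, one_mul, oddDiff]
  linear_combination (1 + X) * one_sub_mul_geom - (1 - X) * one_add_mul_evalNegHom_geom

theorem oddDiff_toSeries_X : (1 - X ^ 2) ^ 2 * oddDiff (toSeries Polynomial.X) = 8 * X := by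
  have h1 := one_sub_mul_geom
  have h2 := one_add_mul_evalNegHom_geom
  simp only [toSeries, Polynomial.aeval_X, joukowski, oddDiff, map_add, map_mul, map_sub, map_one,
    evalNegHom_C, evalNegHom_X, map_ofNat]
  linear_combination (2 * (1 + X) ^ 2 * ((1 - X) * geom + 1) + C (1 / 2) * (1 - X ^ 2) ^ 2) * h1
    - (2 * (1 - X) ^ 2 * ((1 + X) * evalNegHom geom + 1) + C (1 / 2) * (1 - X ^ 2) ^ 2) * h2

/-- The polynomials whose associated odd parts are the remainders. -/
theorem exists_poly_remainder (n : ℕ) :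
    ∃ P : Polynomial ℝ, P.natDegree ≤ n ∧ P.coeff n = leadPoly n ∧
      (1 - X ^ 2) * oddDiff (toSeries P) = 2 * remainder n := by
  induction n using Nat.twoStepInduction with
  | zero => exact ⟨1, by simp, by simp [leadPoly], by simpa [remainder] using oddDiff_toSeries_one⟩
  | one =>
    refine ⟨Polynomial.C (-2 / 9) * Polynomial.X + Polynomial.C (8 / 9) * 1, ?_, ?_, ?_⟩
    · compute_degree
    · simp [leadPoly]
    · rw [toSeries_add, toSeries_C_mul, toSeries_C_mul, oddDiff_add, oddDiff_C_mul, oddDiff_C_mul]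
      have a1 : (C (-2 / 9) : ℝ⟦X⟧) * 9 = -2 := by
        rw [← C_ofNat 9, ← C_ofNat 2, ← map_mul, ← map_neg]; norm_num
      have a2 : (C (8 / 9) : ℝ⟦X⟧) * 9 = 8 := by
        rw [← C_ofNat 9, ← C_ofNat 8, ← map_mul]; norm_num
      have hne : (9 * (1 - X ^ 2) : ℝ⟦X⟧) ≠ 0 :=
        mul_ne_zero (ofNat_ne_zero 9) one_sub_X_sq_ne_zero
      apply mul_left_cancel₀ hne
      simp only [remainder]
      linear_combination 9 * C (-2 / 9) * oddDiff_toSeries_X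
        + 9 * (1 - X ^ 2) * C (8 / 9) * oddDiff_toSeries_one + 8 * X * a1
        + (1 - X ^ 2) * 2 * X * a2 + 2 * tripleAngle_spec
  | more n ih0 ih1 =>
    obtain ⟨P, hP, hPc, hPs⟩ := ih0
    obtain ⟨R, hR, -, hRs⟩ := ih1
    obtain ⟨Q, hQ, hQc, hQs⟩ := exists_mul_tripleAngle_sq P n hP
    refine ⟨R + Polynomial.C (3 * pnum (n + 1)) * Q, ?_, ?_, ?_⟩
    · refine (Polynomial.natDegree_add_le _ _).trans (max_le (by omega) ?_)
      exact (Polynomial.natDegree_C_mul_le _ _).trans hQ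
    · rw [Polynomial.coeff_add, Polynomial.coeff_C_mul, hQc, hPc, leadPoly,
        Polynomial.coeff_eq_zero_of_natDegree_lt (show R.natDegree < n + 2 by omega)]
      ring
    · rw [toSeries_add, toSeries_C_mul, oddDiff_add, oddDiff_C_mul, hQs, map_mul,
        show (C 3 : ℝ⟦X⟧) = 3 from C_ofNat 3, remainder]
      linear_combination hRs + 3 * C (pnum (n + 1)) * tripleAngle ^ 2 * hPs

theorem coeff_toSeries (j : ℕ) (P : Polynomial ℝ)
    (hP : (1 - X ^ 2) * oddDiff (toSeries P) = 2 * remainder j) :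
    (∀ i < j, coeff (2 * i + 1) (toSeries P) = 0) ∧
      coeff (2 * j + 1) (toSeries P) = leadRemainder j := by
  obtain ⟨W, hW, hW0⟩ := remainder_eq_X_pow_mul j
  have hinv : (1 - X ^ 2) * (1 - X ^ 2 : ℝ⟦X⟧)⁻¹ = 1 :=
    PowerSeries.mul_inv_cancel _ (by simp)
  have hodd : oddDiff (toSeries P) = X ^ (2 * j + 1) * (C 2 * (W * (1 - X ^ 2)⁻¹)) := by
    rw [show (C 2 : ℝ⟦X⟧) = 2 from C_ofNat 2]
    linear_combination (1 - X ^ 2)⁻¹ * hP + 2 * (1 - X ^ 2)⁻¹ * hW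
      - oddDiff (toSeries P) * hinv
  have hcoeff : ∀ i, 2 * coeff (2 * i + 1) (toSeries P)
      = coeff (2 * i + 1) (oddDiff (toSeries P)) := by
    intro i
    rw [oddDiff, map_sub, evalNegHom, coeff_rescale, Odd.neg_one_pow ⟨i, rfl⟩]
    ring
  constructor
  · intro i hi
    have := hcoeff i
    rw [hodd, coeff_X_pow_mul', if_neg (by omega)] at this
    linarith
  · have := hcoeff j
    rw [hodd, coeff_X_pow_mul', if_pos le_rfl, Nat.sub_self, coeff_zero_eq_constantCoeff_apply]
      at this
    simp only [map_mul, constantCoeff_C, hW0, PowerSeries.constantCoeff_inv] at this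
    simp at this
    linarith

theorem binom_succ_succ (α : ℤ) (p : ℕ) :
    binom (α + 1) (p + 1) = binom α p + binom α (p + 1) := by
  have hp : ((p : ℝ) + 1) ≠ 0 := by positivity
  have hf : (p.factorial : ℝ) ≠ 0 := by positivity
  unfold binom
  rw [Finset.prod_range_succ', Finset.prod_range_succ, Nat.factorial_succ]
  have : ∀ k ∈ Finset.range p, (((α + 1 : ℤ) : ℝ) - ((k + 1 : ℕ) : ℝ)) = (α : ℝ) - k := by
    intro k _
    push_cast
    ring
  rw [Finset.prod_congr rfl this]
  push_cast
  field_simp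
  ring

theorem binom_zero_right (α : ℤ) : binom α 0 = 1 := by simp [binom]

theorem binom_self_succ (k : ℕ) : binom k (k + 1) = 0 := by
  rw [binom, Finset.prod_eq_zero (Finset.self_mem_range_succ k) (by simp), zero_div]

/-- The generating function of the coefficients `binom (k + m) k`. -/
noncomputable def binomGen (m : ℤ) : ℝ⟦X⟧ := PowerSeries.mk fun k => binom (k + m) k

theorem one_sub_mul_binomGen (m : ℤ) : (1 - X) * binomGen m = binomGen (m - 1) := by
  ext k
  rw [sub_mul, one_mul, map_sub]
  rcases k with - | k
  · simp [binomGen, binom_zero_right]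
  · rw [coeff_succ_X_mul]
    simp only [binomGen, coeff_mk]
    have := binom_succ_succ (k + m) k
    rw [show ((k + 1 : ℕ) : ℤ) + m = k + m + 1 by push_cast; ring,
      show ((k + 1 : ℕ) : ℤ) + (m - 1) = k + m by push_cast; ring, this]
    ring

theorem binomGen_zero : binomGen 0 = geom := by
  have h : binomGen (0 - 1) = 1 := by
    ext k
    rcases k with - | k
    · simp [binomGen, binom_zero_right]
    · simp only [binomGen, coeff_mk]
      rw [show ((k + 1 : ℕ) : ℤ) + (0 - 1) = k by push_cast; ring, binom_self_succ]
      simp [coeff_one]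
  have h1 := one_sub_mul_binomGen 0
  rw [h] at h1
  linear_combination geom * h1 - binomGen 0 * one_sub_mul_geom

theorem geom_pow_mul_geom (j : ℕ) : geom ^ j * geom = binomGen j := by
  induction j with
  | zero => simp [binomGen_zero]
  | succ j ih =>
    have h := one_sub_mul_binomGen (j + 1 : ℕ)
    rw [show ((j + 1 : ℕ) : ℤ) - 1 = j by push_cast; ring, ← ih] at h
    linear_combination -geom * h + binomGen (j + 1 : ℕ) * one_sub_mul_geom

theorem one_sub_pow_mul_geom (j : ℕ) : (1 - X) ^ j * geom = binomGen (-j) := by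
  induction j with
  | zero => simp [binomGen_zero]
  | succ j ih =>
    rw [show (-((j + 1 : ℕ) : ℤ)) = -j - 1 by push_cast; ring, ← one_sub_mul_binomGen, ← ih]
    ring

theorem aeval_chebyshev_C {A : Type*} [CommRing A] [Algebra ℝ A] {y z : A} (h : y * z = 1)
    (j : ℕ) : Polynomial.aeval (y + z) (Polynomial.Chebyshev.C ℝ j) = y ^ j + z ^ j := by
  induction j using Nat.twoStepInduction with
  | zero => rw [Nat.cast_zero, Polynomial.Chebyshev.C_zero, map_ofNat, pow_zero, pow_zero,
      one_add_one_eq_two]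
  | one => simp
  | more j h0 h1 =>
    push_cast at h1 ⊢
    rw [Polynomial.Chebyshev.C_add_two, map_sub, map_mul, h0, h1, Polynomial.aeval_X]
    linear_combination (y ^ j + z ^ j) * h

theorem chebyshev_C_natDegree_coeff (j : ℕ) :
    (Polynomial.Chebyshev.C ℝ j).natDegree ≤ j ∧
      (Polynomial.Chebyshev.C ℝ j).coeff j = if j = 0 then 2 else 1 := by
  induction j using Nat.twoStepInduction with
  | zero => simp
  | one => simp
  | more j h0 h1 =>
    push_cast at h1 ⊢
    rw [Polynomial.Chebyshev.C_add_two]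
    refine ⟨(Polynomial.natDegree_sub_le _ _).trans (max_le ?_ (by omega)), ?_⟩
    · refine Polynomial.natDegree_mul_le.trans ?_
      rw [Polynomial.natDegree_X]
      omega
    · rw [Polynomial.coeff_sub, Polynomial.coeff_X_mul, h1.2,
        Polynomial.coeff_eq_zero_of_natDegree_lt (show _ < j + 2 by omega)]
      simp

theorem entry_eq (i j : ℕ) :
    (4 : ℝ) ^ j * binom (2 * (i : ℤ) + (j : ℤ) + 1) (2 * i + 1)
        + binom (2 * (i : ℤ) - (j : ℤ) + 1) (2 * i + 1)
      = coeff (2 * i + 1) (toSeries (Polynomial.Chebyshev.C ℝ j)) * 2 ^ j := by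
  have h : toSeries (Polynomial.Chebyshev.C ℝ j)
      = C ((2 : ℝ) ^ j) * binomGen j + C ((1 / 2 : ℝ) ^ j) * binomGen (-j) := by
    rw [toSeries, joukowski, aeval_chebyshev_C, ← geom_pow_mul_geom, ← one_sub_pow_mul_geom,
      mul_pow, mul_pow, map_pow, map_pow, show (C 2 : ℝ⟦X⟧) = 2 from C_ofNat 2]
    · ring
    · linear_combination 2 * C (1 / 2) * one_sub_mul_geom + C_half
  rw [h, map_add, coeff_C_mul, coeff_C_mul]
  simp only [binomGen, coeff_mk]
  rw [show ((2 * i + 1 : ℕ) : ℤ) + (j : ℤ) = 2 * (i : ℤ) + (j : ℤ) + 1 by push_cast; ring,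
    show ((2 * i + 1 : ℕ) : ℤ) + (-(j : ℤ)) = 2 * (i : ℤ) - (j : ℤ) + 1 by push_cast; ring]
  have h4 : (4 : ℝ) ^ j = 2 ^ j * 2 ^ j := by rw [← mul_pow]; norm_num
  have h2 : (1 / 2 : ℝ) ^ j * 2 ^ j = 1 := by rw [← mul_pow]; norm_num
  rw [h4]
  linear_combination (-binom (2 * (i : ℤ) - (j : ℤ) + 1) (2 * i + 1)) * h2

theorem det_functional_of_natDegree_le (n : ℕ) (L : ℕ → Polynomial ℝ →ₗ[ℝ] ℝ)
    (P : ℕ → Polynomial ℝ) (hP : ∀ j, (P j).natDegree ≤ j) :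
    (Matrix.of fun i j : Fin n => L i (P j)).det
      = (Matrix.of fun i j : Fin n => L i (Polynomial.X ^ (j : ℕ))).det
        * ∏ j ∈ Finset.range n, (P j).coeff j := by
  have hmul : (Matrix.of fun i j : Fin n => L i (P j))
      = (Matrix.of fun i j : Fin n => L i (Polynomial.X ^ (j : ℕ)))
        * (Matrix.of fun k j : Fin n => (P j).coeff k) := by
    ext i j
    simp only [Matrix.mul_apply, Matrix.of_apply]
    conv_lhs => rw [(P j).as_sum_range' n ((hP j).trans_lt j.2)]
    rw [map_sum, ← Fin.sum_univ_eq_sum_range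
      (fun k => L i (Polynomial.monomial k ((P j).coeff k))) n]
    refine Finset.sum_congr rfl fun k _ => ?_
    rw [← Polynomial.smul_X_eq_monomial, map_smul, smul_eq_mul, mul_comm]
  rw [hmul, Matrix.det_mul]
  congr 1
  rw [Matrix.det_of_isUpperTriangular, ← Fin.prod_univ_eq_prod_range (fun j => (P j).coeff j) n]
  · rfl
  · intro k j hkj
    exact Polynomial.coeff_eq_zero_of_natDegree_lt ((hP j).trans_lt hkj)

/-- The functional `P ↦ coeff (2 * i + 1) (toSeries P)`. -/
noncomputable def oddCoeff (i : ℕ) : Polynomial ℝ →ₗ[ℝ] ℝ where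
  toFun P := coeff (2 * i + 1) (toSeries P)
  map_add' P Q := by rw [toSeries_add, map_add]
  map_smul' a P := by
    rw [Polynomial.smul_eq_C_mul, toSeries_C_mul, coeff_C_mul, RingHom.id_apply, smul_eq_mul]

theorem det_oddCoeff_chebyshev (n : ℕ) (hn : 0 < n) :
    (Matrix.of fun i j : Fin n => oddCoeff i (Polynomial.Chebyshev.C ℝ (j : ℕ))).det
      = 2 * ∏ j ∈ Finset.range n, (leadRemainder j / leadPoly j) := by
  choose P hP hPc hPs using exists_poly_remainder
  have h1 := det_functional_of_natDegree_le n oddCoeff P hP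
  have h2 := det_functional_of_natDegree_le n oddCoeff (fun j => Polynomial.Chebyshev.C ℝ j)
    (fun j => (chebyshev_C_natDegree_coeff j).1)
  have h3 : (Matrix.of fun i j : Fin n => oddCoeff i (P j)).det
      = ∏ j ∈ Finset.range n, leadRemainder j := by
    rw [Matrix.det_of_isLowerTriangular, ← Fin.prod_univ_eq_prod_range leadRemainder n]
    · exact Finset.prod_congr rfl fun j _ => (coeff_toSeries j _ (hPs j)).2
    · intro i j hij
      exact (coeff_toSeries j _ (hPs j)).1 i hij
  have h4 : ∏ j ∈ Finset.range n, (Polynomial.Chebyshev.C ℝ j).coeff j = 2 := by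
    rw [Finset.prod_congr rfl fun j _ => (chebyshev_C_natDegree_coeff j).2,
      Finset.prod_ite_eq' (Finset.range n) 0 (fun _ => (2 : ℝ)), if_pos (by simpa using hn)]
  have h5 : ∏ j ∈ Finset.range n, leadPoly j ≠ 0 :=
    Finset.prod_ne_zero_iff.mpr fun j _ => leadPoly_ne_zero j
  rw [h3, Finset.prod_congr rfl fun j _ => hPc j] at h1
  rw [h2, h4, Finset.prod_div_distrib, h1]
  field_simp

theorem Gamma_eq_of_eq_add_one {x y : ℝ} (hx : 0 < x) (h : y = x + 1) :
    Real.Gamma y = x * Real.Gamma x := by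
  rw [h, Real.Gamma_add_one hx.ne']

theorem leadRemainder_div_leadPoly (n : ℕ) :
    leadRemainder n / leadPoly n * 2 ^ n = 3 ^ n *
      (Real.Gamma (3 * ((n + 1 : ℕ) : ℝ) - 1) * Real.Gamma ((((n + 1 : ℕ) : ℝ) + 1) / 2)
        / (Real.Gamma (2 * ((n + 1 : ℕ) : ℝ)) * Real.Gamma ((3 * ((n + 1 : ℕ) : ℝ) - 1) / 2))) := by
  induction n using Nat.twoStepInduction with
  | zero =>
    norm_num [leadRemainder, leadPoly]
  | one =>
    have h1 : Real.Gamma 5 = 4 * Real.Gamma 4 :=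
      Gamma_eq_of_eq_add_one (by norm_num) (by norm_num)
    have h2 : Real.Gamma (5 / 2) = 3 / 2 * Real.Gamma (3 / 2) :=
      Gamma_eq_of_eq_add_one (by norm_num) (by norm_num)
    have h3 : Real.Gamma 4 ≠ 0 := (Real.Gamma_pos_of_pos (by norm_num)).ne'
    have h4 : Real.Gamma (3 / 2) ≠ 0 := (Real.Gamma_pos_of_pos (by norm_num)).ne'
    norm_num [leadRemainder, leadPoly, pnum, h1, h2]
    field_simp
    norm_num
  | more n ih _ =>
    have hn : (0 : ℝ) ≤ n := Nat.cast_nonneg n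
    have g1 : Real.Gamma (3 * (n : ℝ) + 8) = (3 * n + 7) * ((3 * n + 6) * ((3 * n + 5) *
        ((3 * n + 4) * ((3 * n + 3) * ((3 * n + 2) * Real.Gamma (3 * (n : ℝ) + 2)))))) := by
      rw [Gamma_eq_of_eq_add_one (x := 3 * (n : ℝ) + 7) (by positivity) (by ring),
        Gamma_eq_of_eq_add_one (x := 3 * (n : ℝ) + 6) (by positivity) (by ring),
        Gamma_eq_of_eq_add_one (x := 3 * (n : ℝ) + 5) (by positivity) (by ring),
        Gamma_eq_of_eq_add_one (x := 3 * (n : ℝ) + 4) (by positivity) (by ring),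
        Gamma_eq_of_eq_add_one (x := 3 * (n : ℝ) + 3) (by positivity) (by ring),
        Gamma_eq_of_eq_add_one (x := 3 * (n : ℝ) + 2) (by positivity) (by ring)]
    have g2 : Real.Gamma (((n : ℝ) + 4) / 2) =
        ((n : ℝ) + 2) / 2 * Real.Gamma (((n : ℝ) + 2) / 2) := by
      rw [Gamma_eq_of_eq_add_one (x := ((n : ℝ) + 2) / 2) (by positivity) (by ring)]
    have g3 : Real.Gamma (2 * (n : ℝ) + 6) = (2 * n + 5) * ((2 * n + 4) * ((2 * n + 3) *
        ((2 * n + 2) * Real.Gamma (2 * (n : ℝ) + 2)))) := by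
      rw [Gamma_eq_of_eq_add_one (x := 2 * (n : ℝ) + 5) (by positivity) (by ring),
        Gamma_eq_of_eq_add_one (x := 2 * (n : ℝ) + 4) (by positivity) (by ring),
        Gamma_eq_of_eq_add_one (x := 2 * (n : ℝ) + 3) (by positivity) (by ring),
        Gamma_eq_of_eq_add_one (x := 2 * (n : ℝ) + 2) (by positivity) (by ring)]
    have g4 : Real.Gamma ((3 * (n : ℝ) + 8) / 2) = (3 * (n : ℝ) + 6) / 2 * ((3 * (n : ℝ) + 4) / 2 *
        ((3 * (n : ℝ) + 2) / 2 * Real.Gamma ((3 * (n : ℝ) + 2) / 2))) := by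
      rw [Gamma_eq_of_eq_add_one (x := (3 * (n : ℝ) + 6) / 2) (by positivity) (by ring),
        Gamma_eq_of_eq_add_one (x := (3 * (n : ℝ) + 4) / 2) (by positivity) (by ring),
        Gamma_eq_of_eq_add_one (x := (3 * (n : ℝ) + 2) / 2) (by positivity) (by ring)]
    have p1 : Real.Gamma (3 * (n : ℝ) + 2) ≠ 0 := (Real.Gamma_pos_of_pos (by positivity)).ne'
    have p2 : Real.Gamma (((n : ℝ) + 2) / 2) ≠ 0 := (Real.Gamma_pos_of_pos (by positivity)).ne'
    have p3 : Real.Gamma (2 * (n : ℝ) + 2) ≠ 0 := (Real.Gamma_pos_of_pos (by positivity)).ne'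
    have p4 : Real.Gamma ((3 * (n : ℝ) + 2) / 2) ≠ 0 :=
      (Real.Gamma_pos_of_pos (by positivity)).ne'
    have hr : leadRemainder (n + 2) / leadPoly (n + 2) * 2 ^ (n + 2)
        = 243 * pnum (n + 2) * (leadRemainder n / leadPoly n * 2 ^ n) := by
      have := pnum_ne_zero (n + 1)
      have := leadPoly_ne_zero n
      rw [leadPoly, leadRemainder, Finset.prod_range_succ, Finset.prod_range_succ,
        ← leadRemainder]
      field_simp
      ring
    have hd : pnum (n + 2)
        = (3 * (n : ℝ) + 5) * (3 * n + 7) / (9 * ((2 * (n : ℝ) + 3) * (2 * n + 5))) := by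
      rw [pnum, div_eq_div_iff (four_mul_sq_sub_one_ne_zero _) (by positivity)]
      push_cast
      ring
    rw [hr, ih, hd]
    push_cast
    rw [show 3 * ((n : ℝ) + 2 + 1) - 1 = 3 * n + 8 by ring,
      show ((n : ℝ) + 2 + 1 + 1) / 2 = (n + 4) / 2 by ring,
      show 2 * ((n : ℝ) + 2 + 1) = 2 * n + 6 by ring,
      show 3 * ((n : ℝ) + 1) - 1 = 3 * n + 2 by ring,
      show ((n : ℝ) + 1 + 1) / 2 = (n + 2) / 2 by ring,
      show 2 * ((n : ℝ) + 1) = 2 * n + 2 by ring, g1, g2, g3, g4]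
    field_simp
    ring

theorem prod_Icc_one_eq_prod_range (f : ℕ → ℝ) (n : ℕ) :
    ∏ i ∈ Finset.Icc 1 n, f i = ∏ i ∈ Finset.range n, f (i + 1) := by
  induction n with
  | zero => simp
  | succ n ih => rw [Finset.prod_Icc_succ_top (by omega), ih, Finset.prod_range_succ]

end AztecDet

theorem stmt_4 (n : ℕ) (hn : 0 < n) :
    (Matrix.of fun i j : Fin n =>
        (4 : ℝ) ^ (j : ℕ) * binom (2 * ((i : ℕ) : ℤ) + ((j : ℕ) : ℤ) + 1) (2 * (i : ℕ) + 1)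
          + binom (2 * ((i : ℕ) : ℤ) - ((j : ℕ) : ℤ) + 1) (2 * (i : ℕ) + 1)).det =
      2 * 3 ^ (n * (n - 1) / 2) * ∏ i ∈ Finset.Icc 1 n,
          Real.Gamma (3 * (i : ℝ) - 1) * Real.Gamma (((i : ℝ) + 1) / 2)
            / (Real.Gamma (2 * (i : ℝ)) * Real.Gamma ((3 * (i : ℝ) - 1) / 2)) := by
  have hM : (Matrix.of fun i j : Fin n =>
        (4 : ℝ) ^ (j : ℕ) * binom (2 * ((i : ℕ) : ℤ) + ((j : ℕ) : ℤ) + 1) (2 * (i : ℕ) + 1)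
          + binom (2 * ((i : ℕ) : ℤ) - ((j : ℕ) : ℤ) + 1) (2 * (i : ℕ) + 1))
      = Matrix.of fun i j : Fin n => (2 : ℝ) ^ (j : ℕ) *
          (Matrix.of fun i j : Fin n =>
            AztecDet.oddCoeff i (Polynomial.Chebyshev.C ℝ (j : ℕ))) i j := by
    ext i j
    rw [Matrix.of_apply, AztecDet.entry_eq, mul_comm]
    rfl
  rw [hM, Matrix.det_mul_row, AztecDet.det_oddCoeff_chebyshev n hn,
    Fin.prod_univ_eq_prod_range (fun j => (2 : ℝ) ^ j) n, mul_left_comm, mul_assoc,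
    ← Finset.prod_mul_distrib, AztecDet.prod_Icc_one_eq_prod_range, ← Finset.sum_range_id,
    ← Finset.prod_pow_eq_pow_sum, ← Finset.prod_mul_distrib]
  congr 1
  refine Finset.prod_congr rfl fun j _ => ?_
  rw [mul_comm, AztecDet.leadRemainder_div_leadPoly]
end

section
/- For every positive integer n, the determinant of the n×n matrix whose (i,j)-entry (0 ≤ i,j ≤ n−1) is 3^{j}·binom(3i+j, 3i) + binom(3i−j, 3i) equals 2·2^{n(n−1)/2} times the product over i = 1 to n of Γ(4i−3)·Γ((i+1)/3) / (Γ(3i−2)·Γ((4i−2)/3)). -/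
open scoped BigOperators

namespace TwentyVertex

open PowerSeries

/-- The coefficients of the solution of `S' = c * S` with constant coefficient one. -/
noncomputable def expCoeff (c : ℝ⟦X⟧) : ℕ → ℝ
  | 0 => 1
  | m + 1 => (∑ i : Fin (m + 1), expCoeff c i * coeff (m - i) c) / (m + 1)

theorem exists_derivative_eq_mul (c : ℝ⟦X⟧) :
    ∃ S : ℝ⟦X⟧, constantCoeff S = 1 ∧ derivative ℝ S = c * S := by
  refine ⟨mk (expCoeff c), by simp [expCoeff], ?_⟩
  ext m
  rw [coeff_derivative, coeff_mk, expCoeff, div_mul_cancel₀ _ (by positivity), mul_comm c,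
    coeff_mul, Finset.Nat.sum_antidiagonal_eq_sum_range_succ_mk, Finset.sum_range]
  simp

/-- The `X`-logarithmic derivative of `(b / a) ^ n * √b / a`, where `a = 1 - 3x + 3x²` and
`b = (1 - x)(1 - 3x)(1 + 3x²)`; the arguments `p, q, r, s, h` stand for the inverses of
`1 - x`, `1 - 3x`, `1 + 3x²`, `a` and `2`. -/
def weightLog {R : Type*} [CommRing R] (x p q r s h n : R) : R :=
  (n + h) * (-x * p - 3 * x * q + 6 * x ^ 2 * r) - (n + 1) * (-3 * x + 6 * x ^ 2) * s

theorem weight_identities {R : Type*} [CommRing R] [IsDomain R] (x p q r s h k n : R)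
    (hp : p * (1 - x) = 1) (hq : q * (1 - 3 * x) = 1)
    (hr : r * (1 + 3 * x ^ 2) = 1) (hs : s * (1 - 3 * x + 3 * x ^ 2) = 1) (hh : h * 2 = 1) :
    (3 * x * q * (3 * k + 6) + (-3 * x + 6 * x ^ 2) * s + 6 * x ^ 2 * r - x * p
        + weightLog x p q r s h n - n)
        * (-27 * q ^ 6 * (1 - 3 * x + 3 * x ^ 2) * (1 + 3 * x ^ 2) * (1 - x)) =
      (3 * k + 1 - n) * q + (21 * k + 43 + 20 * n) * q ^ 4 - 4 * (6 * k + 11 - 2 * n) * q ^ 7 ∧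
    ((1 + x * p) * (3 * k + 1) + 5 * x * p + (-3 * x + 6 * x ^ 2) * s + 6 * x ^ 2 * r - 3 * x * q
        + weightLog x p q r s h n - n)
        * ((-x * p) * p ^ 5 * (1 - 3 * x + 3 * x ^ 2) * (1 + 3 * x ^ 2) * (1 - 3 * x)) =
      (3 * k + 1 - n) * (-x * p) + (21 * k + 43 + 20 * n) * (-x * p) ^ 4
        - 4 * (6 * k + 11 - 2 * n) * (-x * p) ^ 7 ∧
    ((-20 * x + 36 * x ^ 2) + (6 - 20 * x + 18 * x ^ 2) * (9 * x * q + 3 * x * p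
        + (-3 * x + 6 * x ^ 2) * s + 6 * x ^ 2 * r + weightLog x p q r s h n - n))
        * (q ^ 3 * p ^ 3 * (1 - 3 * x + 3 * x ^ 2) * (1 + 3 * x ^ 2)) =
      (5 - 2 * n) * (q ^ 4 - (-x * p) ^ 4) - (5 + 4 * n) * (q - -x * p) ∧
    q * (1 - q ^ 3) * ((1 - x) * (1 - 3 * x) * (1 + 3 * x ^ 2) * s) = -x * (1 + 8 * q ^ 3) ∧
    (-x * p) * (1 - (-x * p) ^ 3) * ((1 - x) * (1 - 3 * x) * (1 + 3 * x ^ 2) * s) =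
      -x * (1 + 8 * (-x * p) ^ 3) := by
  have hp' := congrArg (algebraMap R (FractionRing R)) hp
  have hq' := congrArg (algebraMap R (FractionRing R)) hq
  have hr' := congrArg (algebraMap R (FractionRing R)) hr
  have hs' := congrArg (algebraMap R (FractionRing R)) hs
  have hh' := congrArg (algebraMap R (FractionRing R)) hh
  simp only [← (IsFractionRing.injective R (FractionRing R)).eq_iff]
  unfold weightLog
  simp only [map_mul, map_sub, map_add, map_one, map_pow, map_ofNat, map_neg]
    at hp' hq' hr' hs' hh' ⊢
  generalize algebraMap R (FractionRing R) x = x at *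
  generalize algebraMap R (FractionRing R) p = p at *
  generalize algebraMap R (FractionRing R) q = q at *
  generalize algebraMap R (FractionRing R) r = r at *
  generalize algebraMap R (FractionRing R) s = s at *
  generalize algebraMap R (FractionRing R) h = h at *
  have h1 := right_ne_zero_of_mul_eq_one hp'
  have h2 := right_ne_zero_of_mul_eq_one hq'
  have h3 := right_ne_zero_of_mul_eq_one hr'
  have h4 := right_ne_zero_of_mul_eq_one hs'
  have h5 := right_ne_zero_of_mul_eq_one hh'
  obtain rfl := eq_inv_of_mul_eq_one_left hp'
  obtain rfl := eq_inv_of_mul_eq_one_left hq'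
  obtain rfl := eq_inv_of_mul_eq_one_left hr'
  obtain rfl := eq_inv_of_mul_eq_one_left hs'
  obtain rfl := eq_inv_of_mul_eq_one_left hh'
  clear hp' hq' hr' hs' hh' hp hq hr hs hh
  generalize ha : 1 - x = a at *
  generalize hb : 1 - 3 * x = b at *
  generalize hc : 1 + 3 * x ^ 2 = c at *
  generalize hd : b + 3 * x ^ 2 = d at *
  refine ⟨?_, ?_, ?_, ?_, ?_⟩ <;> by_cases h0 : x = 0 <;> field_simp <;>
    simp only [← hd, ← hc, ← hb, ← ha] <;> ring

/-- `u = 1 / (1 - 3X)`. -/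
noncomputable def u : ℝ⟦X⟧ := (1 - 3 * X)⁻¹

/-- `p = 1 / (1 - X)`. -/
noncomputable def p : ℝ⟦X⟧ := (1 - X)⁻¹

/-- The generating function of a row, up to a constant. -/
noncomputable def rowSeries (k : ℕ) : ℝ⟦X⟧ := u ^ (3 * k + 1) - (-X * p) ^ (3 * k + 1)

theorem logDeriv_mul {f g l m : ℝ⟦X⟧} (hf : X * derivative ℝ f = l * f)
    (hg : X * derivative ℝ g = m * g) : X * derivative ℝ (f * g) = (l + m) * (f * g) := by
  rw [Derivation.leibniz, smul_eq_mul, smul_eq_mul]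
  linear_combination f * hg + g * hf

theorem logDeriv_pow {f l : ℝ⟦X⟧} (hf : X * derivative ℝ f = l * f) (n : ℕ) :
    X * derivative ℝ (f ^ n) = ((n : ℝ⟦X⟧) * l) * f ^ n := by
  induction n with
  | zero => simp
  | succ n ih => rw [pow_succ, logDeriv_mul ih hf]; push_cast; ring

theorem logDeriv_of_mul_eq_one {f g m : ℝ⟦X⟧} (h : f * g = 1)
    (hg : X * derivative ℝ g = m * g) : X * derivative ℝ f = (-m) * f := by
  have h1 := congrArg (derivative ℝ) h
  rw [Derivation.leibniz, smul_eq_mul, smul_eq_mul, derivative_one] at h1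
  linear_combination X * f * h1 - f ^ 2 * hg - X * derivative ℝ f * h - m * f * h

theorem coeff_eq_zero_of_logDeriv {f : ℝ⟦X⟧} (n : ℕ) :
    coeff n (X * derivative ℝ f - (n : ℝ⟦X⟧) * f) = 0 := by
  rw [map_sub, ← map_natCast (C : ℝ →+* ℝ⟦X⟧), coeff_C_mul]
  cases n with
  | zero => simp
  | succ n => rw [coeff_succ_X_mul, coeff_derivative]; push_cast; ring

/-- Weights `E N` for which the numbers `coeff N (rowSeries k * E N)` satisfy linear
recurrences in `k` and `N`. -/
theorem exists_weights : ∃ E : ℕ → ℝ⟦X⟧, (∀ N, constantCoeff (E N) = 1) ∧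
    (∀ N k : ℕ,
      (3 * k + 1 - N : ℝ) * coeff N (rowSeries k * E N)
        + (21 * k + 43 + 20 * N) * coeff N (rowSeries (k + 1) * E N)
        - 4 * (6 * k + 11 - 2 * N) * coeff N (rowSeries (k + 2) * E N) = 0) ∧
    (∀ N : ℕ, (5 - 2 * N : ℝ) * coeff N (rowSeries 1 * E N) =
      (5 + 4 * N) * coeff N (rowSeries 0 * E N)) ∧
    ∀ N : ℕ, coeff (N + 3) (rowSeries 1 * E (N + 3)) - 3 * coeff (N + 3) (rowSeries 2 * E (N + 3))
        + 3 * coeff (N + 3) (rowSeries 3 * E (N + 3)) - coeff (N + 3) (rowSeries 4 * E (N + 3)) =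
      -(coeff N (rowSeries 0 * E N) + 24 * coeff N (rowSeries 1 * E N)
        + 192 * coeff N (rowSeries 2 * E N) + 512 * coeff N (rowSeries 3 * E N)) := by
  have d3 : derivative ℝ (3 : ℝ⟦X⟧) = 0 := by
    rw [← map_ofNat (C : ℝ →+* ℝ⟦X⟧) 3]; exact derivative_C
  have hp : p * (1 - X : ℝ⟦X⟧) = 1 := PowerSeries.inv_mul_cancel _ (by simp)
  have hq : u * (1 - 3 * X : ℝ⟦X⟧) = 1 := PowerSeries.inv_mul_cancel _ (by simp)
  obtain ⟨r, hr⟩ : ∃ r : ℝ⟦X⟧, r * (1 + 3 * X ^ 2) = 1 :=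
    ⟨_, PowerSeries.inv_mul_cancel _ (by simp)⟩
  obtain ⟨s, hs⟩ : ∃ s : ℝ⟦X⟧, s * (1 - 3 * X + 3 * X ^ 2) = 1 :=
    ⟨_, PowerSeries.inv_mul_cancel _ (by simp)⟩
  have hs0 : constantCoeff s = 1 := by simpa using congrArg constantCoeff hs
  set h : ℝ⟦X⟧ := C (1 / 2)
  have hh : h * 2 = 1 := by
    rw [← map_ofNat (C : ℝ →+* ℝ⟦X⟧) 2, ← map_mul]; norm_num
  have l1 : X * derivative ℝ (1 - X : ℝ⟦X⟧) = (-X * p) * (1 - X) := by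
    simp; linear_combination -X * hp
  have l2 : X * derivative ℝ (1 - 3 * X : ℝ⟦X⟧) = (-3 * X * u) * (1 - 3 * X) := by
    simp [d3, Derivation.leibniz]; linear_combination -3 * X * hq
  have l3 : X * derivative ℝ (1 + 3 * X ^ 2 : ℝ⟦X⟧) = (6 * X ^ 2 * r) * (1 + 3 * X ^ 2) := by
    simp [d3, Derivation.leibniz]; linear_combination -6 * X ^ 2 * hr
  have l4 : X * derivative ℝ (1 - 3 * X + 3 * X ^ 2 : ℝ⟦X⟧) =
      ((-3 * X + 6 * X ^ 2) * s) * (1 - 3 * X + 3 * X ^ 2) := by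
    simp [d3, Derivation.leibniz]; linear_combination (3 * X - 6 * X ^ 2) * hs
  have lp := logDeriv_of_mul_eq_one hp l1
  have lu := logDeriv_of_mul_eq_one hq l2
  have ls := logDeriv_of_mul_eq_one hs l4
  have lX : X * derivative ℝ (-X : ℝ⟦X⟧) = 1 * (-X) := by simp
  have lv := logDeriv_mul lX lp
  obtain ⟨S, hS0, hS⟩ := exists_derivative_eq_mul (h * (-p - 3 * u + 6 * X * r))
  have lS : X * derivative ℝ S = (h * (-X * p - 3 * X * u + 6 * X ^ 2 * r)) * S := by
    rw [hS]; ring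
  set b : ℝ⟦X⟧ := (1 - X) * (1 - 3 * X) * (1 + 3 * X ^ 2) with hb
  have lb := logDeriv_mul (logDeriv_mul l1 l2) l3
  have lE (N : ℕ) : X * derivative ℝ (b ^ N * s ^ (N + 1) * S) =
      weightLog X p u r s h N * (b ^ N * s ^ (N + 1) * S) := by
    rw [logDeriv_mul (logDeriv_mul (logDeriv_pow lb N) (logDeriv_pow ls (N + 1))) lS]
    unfold weightLog; push_cast; ring
  refine ⟨fun N => b ^ N * s ^ (N + 1) * S, fun N => by simp [hb, hs0, hS0], fun N k => ?_,
    fun N => ?_, fun N => ?_⟩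
  · obtain ⟨iu, iv, -⟩ := weight_identities (X : ℝ⟦X⟧) p u r s h k N hp hq hr hs hh
    beta_reduce
    specialize lE N
    generalize b ^ N * s ^ (N + 1) * S = E at lE ⊢
    have e1 := coeff_eq_zero_of_logDeriv (f := u ^ (3 * k + 6) * (1 - 3 * X + 3 * X ^ 2) *
      (1 + 3 * X ^ 2) * (1 - X) * E) N
    rw [logDeriv_mul (logDeriv_mul (logDeriv_mul (logDeriv_mul (logDeriv_pow lu _) l4) l3) l1) lE]
      at e1
    have e2 := coeff_eq_zero_of_logDeriv (f := (-X * p) ^ (3 * k + 1) * p ^ 5 *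
      (1 - 3 * X + 3 * X ^ 2) * (1 + 3 * X ^ 2) * (1 - 3 * X) * E) N
    rw [logDeriv_mul (logDeriv_mul (logDeriv_mul (logDeriv_mul (logDeriv_mul (logDeriv_pow lv _)
      (logDeriv_pow lp _)) l4) l3) l2) lE] at e2
    have e := congrArg₂ (fun a b => (-27 : ℝ) * a - b) e1 e2
    simp only [← coeff_C_mul, ← map_sub, ← map_add] at e ⊢
    refine (congrArg (coeff N) ?_).trans (e.trans (by norm_num))
    simp only [rowSeries, map_add, map_sub, map_mul, map_ofNat, map_natCast, map_one, map_neg]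
    push_cast
    linear_combination -(u ^ (3 * k) * E) * iu + ((-X * p) ^ (3 * k) * E) * iv
  · obtain ⟨-, -, ib, -⟩ := weight_identities (X : ℝ⟦X⟧) p u r s h 0 N hp hq hr hs hh
    beta_reduce
    specialize lE N
    generalize b ^ N * s ^ (N + 1) * S = E at lE ⊢
    have lG := logDeriv_mul (logDeriv_mul (logDeriv_mul (logDeriv_mul (logDeriv_pow lu 3)
      (logDeriv_pow lp 3)) l4) l3) lE
    have d (n : ℕ) [n.AtLeastTwo] : derivative ℝ (OfNat.ofNat n : ℝ⟦X⟧) = 0 := by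
      rw [← map_ofNat (C : ℝ →+* ℝ⟦X⟧) n]; exact derivative_C
    have lP : X * derivative ℝ (6 - 20 * X + 18 * X ^ 2 : ℝ⟦X⟧) = -20 * X + 36 * X ^ 2 := by
      simp [d, Derivation.leibniz]; ring
    have e := coeff_eq_zero_of_logDeriv (f := (6 - 20 * X + 18 * X ^ 2) * (u ^ 3 * p ^ 3 *
      (1 - 3 * X + 3 * X ^ 2) * (1 + 3 * X ^ 2) * E)) N
    rw [Derivation.leibniz, smul_eq_mul, smul_eq_mul, mul_add, mul_left_comm X, lG,
      mul_left_comm X, lP] at e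
    rw [← sub_eq_zero]
    simp only [← coeff_C_mul, ← map_sub] at e ⊢
    refine (congrArg (coeff N) ?_).trans e
    simp only [rowSeries, map_add, map_sub, map_mul, map_ofNat, map_natCast]
    linear_combination -E * ib
  · obtain ⟨-, -, -, cu, cv⟩ := weight_identities (X : ℝ⟦X⟧) p u r s h 0 N hp hq hr hs hh
    beta_reduce
    rw [← coeff_X_pow_mul _ 3 N, ← coeff_X_pow_mul _ 3 N, ← coeff_X_pow_mul _ 3 N,
      ← coeff_X_pow_mul _ 3 N, ← neg_eq_iff_eq_neg]
    have hE : b ^ (N + 3) * s ^ (N + 3 + 1) * S = (b * s) ^ 3 * (b ^ N * s ^ (N + 1) * S) := by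
      ring
    rw [hE]
    generalize b ^ N * s ^ (N + 1) * S = E
    simp only [← coeff_C_mul, ← map_sub, ← map_add, ← map_neg]
    congr 1
    simp only [rowSeries, map_ofNat]
    linear_combination -(u * E) * congrArg (· ^ 3) cu + (-X * p) * E * congrArg (· ^ 3) cv

theorem binom_natCast (n d : ℕ) : binom n d = n.choose d := by
  rw [binom, Int.cast_natCast, ← descPochhammer_eval_eq_prod_range,
    descPochhammer_eval_eq_descFactorial, Nat.descFactorial_eq_factorial_mul_choose, Nat.cast_mul,
    mul_div_cancel_left₀ _ (by positivity)]

theorem binom_neg_succ (m d : ℕ) : binom (-(m + 1)) d = (-1) ^ d * (m + d).choose d := by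
  have h : ∏ k ∈ Finset.range d, ((-(m + 1) : ℝ) - k) = (-1) ^ d * ((m + 1).ascFactorial d : ℝ) := by
    rw [Nat.ascFactorial_eq_prod_range, Nat.cast_prod, ← Finset.card_range d,
      ← Finset.prod_const, Finset.card_range, ← Finset.prod_mul_distrib]
    exact Finset.prod_congr rfl fun _ _ => by push_cast; ring
  rw [binom]
  push_cast
  rw [h, Nat.ascFactorial_eq_factorial_mul_choose, Nat.cast_mul, mul_div_assoc,
    mul_div_cancel_left₀ _ (by positivity)]

theorem p_eq : p = mk 1 := by
  rw [p, eq_comm, eq_inv_iff_mul_eq_one (by simp)]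
  exact mk_one_mul_one_sub_eq_one ℝ

theorem u_eq : u = rescale 3 (mk 1) := by
  rw [u, eq_comm, eq_inv_iff_mul_eq_one (by simp)]
  have := congrArg (rescale (3 : ℝ)) (mk_one_mul_one_sub_eq_one ℝ)
  rw [map_mul, map_sub, map_one, rescale_X, map_ofNat] at this
  exact this

theorem coeff_u_pow_succ (d j : ℕ) : coeff j (u ^ (d + 1)) = 3 ^ j * ((d + j).choose d : ℝ) := by
  rw [u_eq, ← map_pow, mk_one_pow_eq_mk_choose_add, coeff_rescale, coeff_mk]

theorem coeff_rowSeries (i j : ℕ) (hj : j ≠ 0) : coeff j (rowSeries i) =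
    3 ^ j * binom (3 * (i : ℤ) + j) (3 * i) + binom (3 * (i : ℤ) - j) (3 * i) := by
  have h := binom_natCast (3 * i + j) (3 * i)
  push_cast at h
  rw [h, rowSeries, map_sub, coeff_u_pow_succ, mul_pow, neg_pow, mul_assoc, ← map_one C,
    ← map_neg C, ← map_pow C, coeff_C_mul, sub_eq_add_neg, add_right_inj, coeff_X_pow_mul', p_eq,
    mk_one_pow_eq_mk_choose_add]
  split_ifs with hi
  · obtain ⟨m, rfl⟩ := Nat.exists_eq_add_of_le hi
    have h := binom_neg_succ m (3 * i)
    rw [Nat.add_sub_cancel_left, coeff_mk, add_comm _ m,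
      show 3 * (i : ℤ) - (3 * i + 1 + m : ℕ) = -(m + 1) by push_cast; ring, h, pow_succ]
    ring_nf
  · have h := binom_natCast (3 * i - j) (3 * i)
    rw [Nat.choose_eq_zero_of_lt (by omega), Nat.cast_sub (by omega)] at h
    push_cast at h
    rw [h]; simp

theorem coeff_zero_rowSeries (i : ℕ) : coeff 0 (rowSeries i) = 1 := by
  simp [rowSeries, u]

theorem entry_eq (i j : ℕ) :
    3 ^ j * binom (3 * (i : ℤ) + j) (3 * i) + binom (3 * (i : ℤ) - j) (3 * i) =
      (if j = 0 then 2 else 1) * coeff j (rowSeries i) := by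
  split_ifs with hj
  · subst hj
    have h := binom_natCast (3 * i) (3 * i)
    push_cast at h
    simp only [CharP.cast_eq_zero, add_zero, sub_zero, coeff_zero_rowSeries, h]
    norm_num
  · rw [coeff_rowSeries i j hj, one_mul]

/-- The numerator of `coeff N (rowSeries k * E N)` as a polynomial in `N`. -/
noncomputable def numer : ℕ → Polynomial ℝ
  | 0 => 1
  | 1 => Polynomial.C (-4) * Polynomial.X + Polynomial.C (-5)
  | k + 2 => Polynomial.C (1 / 4) *
      ((Polynomial.X - Polynomial.C (3 * k + 1 : ℝ)) *
          (Polynomial.C 2 * Polynomial.X - Polynomial.C (5 + 6 * k : ℝ)) * numer k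
        - (Polynomial.C 20 * Polynomial.X + Polynomial.C (21 * k + 43 : ℝ)) * numer (k + 1))

/-- The denominator of `coeff N (rowSeries k * E N)` as a function of `N`. -/
noncomputable def denom (k : ℕ) (x : ℝ) : ℝ := ∏ i ∈ Finset.range k, (2 * x - 5 - 6 * i)

theorem numer_succ_succ_eval (k : ℕ) (x : ℝ) : (numer (k + 2)).eval x =
    ((x - (3 * k + 1)) * (2 * x - (5 + 6 * k)) * (numer k).eval x
      - (20 * x + (21 * k + 43)) * (numer (k + 1)).eval x) / 4 := by
  simp [numer]; ring

theorem numer_zero_eval (x : ℝ) : (numer 0).eval x = 1 := by simp [numer]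

theorem numer_one_eval (x : ℝ) : (numer 1).eval x = -(4 * x + 5) := by simp [numer]; ring

theorem natDegree_numer (k : ℕ) : (numer k).natDegree ≤ k ∧ (numer (k + 1)).natDegree ≤ k + 1 := by
  induction k with
  | zero => exact ⟨by simp [numer], by rw [numer]; compute_degree⟩
  | succ k ih =>
    refine ⟨ih.2, ?_⟩
    obtain ⟨h1, h2⟩ := ih
    rw [numer]
    refine (Polynomial.natDegree_C_mul_le _ _).trans ?_
    refine (Polynomial.natDegree_sub_le _ _).trans (max_le ?_ ?_)
    · have h : ((Polynomial.X - Polynomial.C (3 * k + 1 : ℝ)) *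
          (Polynomial.C 2 * Polynomial.X - Polynomial.C (5 + 6 * k : ℝ))).natDegree ≤ 2 := by
        compute_degree
      refine Polynomial.natDegree_mul_le.trans (by omega)
    · have h : (Polynomial.C 20 * Polynomial.X + Polynomial.C (21 * k + 43 : ℝ)).natDegree ≤ 1 := by
        compute_degree
      refine Polynomial.natDegree_mul_le.trans (by omega)

theorem denom_succ (k : ℕ) (x : ℝ) : denom (k + 1) x = denom k x * (2 * x - 5 - 6 * k) :=
  Finset.prod_range_succ _ _

theorem denom_factor_ne_zero (i N : ℕ) : (2 * N - 5 - 6 * i : ℝ) ≠ 0 := by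
  have h : (2 * N - 5 - 6 * i : ℤ) ≠ 0 := by omega
  exact_mod_cast h

theorem denom_ne_zero (k N : ℕ) : denom k N ≠ 0 :=
  Finset.prod_ne_zero_iff.2 fun i _ => denom_factor_ne_zero i N

section Moments

variable {M : ℕ → ℕ → ℝ}

theorem eq_numer_div_denom
    (hrec : ∀ N k : ℕ, (3 * k + 1 - N : ℝ) * M k N + (21 * k + 43 + 20 * N) * M (k + 1) N
      - 4 * (6 * k + 11 - 2 * N) * M (k + 2) N = 0)
    (hone : ∀ N : ℕ, (5 - 2 * N : ℝ) * M 1 N = (5 + 4 * N) * M 0 N) (k N : ℕ) :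
    M k N = M 0 N * ((numer k).eval (N : ℝ) / denom k N) ∧
    M (k + 1) N = M 0 N * ((numer (k + 1)).eval (N : ℝ) / denom (k + 1) N) := by
  induction k with
  | zero =>
    refine ⟨by simp [numer, denom], ?_⟩
    have h := denom_factor_ne_zero 0 N
    rw [denom_succ, numer_one_eval]
    simp only [denom, Finset.range_zero, Finset.prod_empty, CharP.cast_eq_zero, zero_add, one_mul]
      at h ⊢
    rw [← mul_div_assoc, eq_div_iff h]
    linear_combination -hone N
  | succ k ih =>
    refine ⟨ih.2, ?_⟩
    obtain ⟨h1, h2⟩ := ih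
    have h := hrec N k
    have hk := denom_factor_ne_zero k N
    have hk' := denom_factor_ne_zero (k + 1) N
    have hd := denom_ne_zero k N
    rw [h1, h2, denom_succ] at h
    rw [numer_succ_succ_eval, denom_succ, denom_succ]
    push_cast at *
    generalize hc : 2 * (N : ℝ) - 5 - 6 * (k + 1) = c' at *
    rw [show 4 * (6 * k + 11 - 2 * N : ℝ) = -4 * c' by rw [← hc]; ring] at h
    rw [show (2 * N - (5 + 6 * k) : ℝ) = 2 * N - 5 - 6 * k by ring]
    generalize 2 * (N : ℝ) - 5 - 6 * k = c at *
    field_simp at h ⊢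
    linear_combination h

theorem zero_add_three
    (hnum : ∀ N k : ℕ, M k N = M 0 N * ((numer k).eval (N : ℝ) / denom k N))
    (hshift : ∀ N : ℕ, M 1 (N + 3) - 3 * M 2 (N + 3) + 3 * M 3 (N + 3) - M 4 (N + 3) =
      -(M 0 N + 24 * M 1 N + 192 * M 2 N + 512 * M 3 N)) (N : ℕ) :
    M 0 (N + 3) * ((N + 1) * (N + 2) * (N + 3)) =
      -8 * (2 * N + 1) * (2 * N + 3) * (2 * N + 5) * M 0 N := by
  have h := hshift N
  rw [hnum (N + 3) 1, hnum (N + 3) 2, hnum (N + 3) 3, hnum (N + 3) 4, hnum N 1, hnum N 2, hnum N 3]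
    at h
  simp only [denom, Finset.prod_range_succ, Finset.prod_range_zero, numer_succ_succ_eval,
    numer_zero_eval, numer_one_eval, zero_add] at h
  have h0 := denom_factor_ne_zero 0 N
  have h1 := denom_factor_ne_zero 1 N
  have h2 := denom_factor_ne_zero 2 N
  have h0' := denom_factor_ne_zero 0 (N + 3)
  have h1' := denom_factor_ne_zero 1 (N + 3)
  have h2' := denom_factor_ne_zero 2 (N + 3)
  have h3' := denom_factor_ne_zero 3 (N + 3)
  have hl : (45441 + 11502 * N : ℝ) ≠ 0 := by positivity
  push_cast at *
  generalize hc0 : (2 * (N + 3) - 5 - 6 * 0 : ℝ) = c0 at *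
  generalize hc1 : (2 * (N + 3) - 5 - 6 * 1 : ℝ) = c1 at *
  generalize hc2 : (2 * (N + 3) - 5 - 6 * 2 : ℝ) = c2 at *
  generalize hc3 : (2 * (N + 3) - 5 - 6 * 3 : ℝ) = c3 at *
  rw [show (2 * N - 5 - 6 * 0 : ℝ) = c1 by rw [← hc1]; ring,
    show (2 * N - 5 - 6 * 1 : ℝ) = c2 by rw [← hc2]; ring,
    show (2 * N - 5 - 6 * 2 : ℝ) = c3 by rw [← hc3]; ring] at h
  field_simp at h
  refine mul_left_cancel₀ hl ?_
  simp only [← hc0, ← hc1, ← hc2, ← hc3] at h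
  linear_combination (-1 / 8) * h

end Moments

theorem descPochhammer_eval_pos (k : ℕ) : 0 < (descPochhammer ℝ k).eval (3 * k - 1 / 2 : ℝ) := by
  rw [descPochhammer_eval_eq_prod_range]
  refine Finset.prod_pos fun j hj => ?_
  have h : (j + 1 : ℝ) ≤ k := by exact_mod_cast Finset.mem_range.1 hj
  linarith [(Nat.cast_nonneg j : (0 : ℝ) ≤ j)]

/-- A polynomial of degree at most `k` over `denom k` is a combination of the functions
`N.descFactorial j / denom j N` with `j ≤ k`; the last coefficient is read off at the last zero of
`denom k`, up to a shift. -/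
theorem exists_expansion (k : ℕ) (P : Polynomial ℝ) (hP : P.natDegree ≤ k) : ∃ L : ℕ → ℝ,
    (∀ N : ℕ, P.eval (N : ℝ) / denom k N =
      ∑ j ∈ Finset.range (k + 1), L j * ((N.descFactorial j : ℝ) / denom j N)) ∧
    L k * (descPochhammer ℝ k).eval (3 * k - 1 / 2 : ℝ) = P.eval (3 * k - 1 / 2 : ℝ) := by
  induction k generalizing P with
  | zero =>
    rw [Polynomial.eq_C_of_natDegree_le_zero hP]
    exact ⟨fun _ => P.coeff 0, by simp [denom], by simp⟩
  | succ k ih =>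
    have hf := (descPochhammer_eval_pos (k + 1)).ne'
    set x : ℝ := 3 * (k + 1 : ℕ) - 1 / 2 with hx
    set c := P.eval x / (descPochhammer ℝ (k + 1)).eval x with hc
    obtain ⟨R, hR⟩ : Polynomial.X - Polynomial.C x ∣
        P - Polynomial.C c * descPochhammer ℝ (k + 1) := by
      rw [Polynomial.dvd_iff_isRoot, Polynomial.IsRoot, Polynomial.eval_sub, Polynomial.eval_mul,
        Polynomial.eval_C, hc, div_mul_cancel₀ _ hf, sub_self]
    have hdeg : R.natDegree ≤ k := by
      have h : (P - Polynomial.C c * descPochhammer ℝ (k + 1)).natDegree ≤ k + 1 := by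
        refine (Polynomial.natDegree_sub_le _ _).trans (max_le hP ?_)
        exact (Polynomial.natDegree_C_mul_le _ _).trans (descPochhammer_natDegree ℝ (k + 1)).le
      rcases eq_or_ne R 0 with rfl | h0
      · simp
      rw [hR, Polynomial.natDegree_mul (Polynomial.X_sub_C_ne_zero x) h0,
        Polynomial.natDegree_X_sub_C] at h
      omega
    obtain ⟨L, hL, -⟩ := ih R hdeg
    refine ⟨fun j => if j = k + 1 then c else L j / 2, fun N => ?_, ?_⟩
    · have hPN := congrArg (Polynomial.eval (N : ℝ)) hR
      simp only [Polynomial.eval_sub, Polynomial.eval_mul, Polynomial.eval_C, Polynomial.eval_X,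
        descPochhammer_eval_eq_descFactorial] at hPN
      rw [Finset.sum_range_succ]
      beta_reduce
      rw [if_pos rfl]
      have hs : ∑ j ∈ Finset.range (k + 1), (if j = k + 1 then c else L j / 2) *
          ((N.descFactorial j : ℝ) / denom j N) = R.eval (N : ℝ) / denom k N / 2 := by
        rw [hL, Finset.sum_div]
        refine Finset.sum_congr rfl fun j hj => ?_
        rw [if_neg (Finset.mem_range.1 hj).ne]
        ring
      have hd := denom_ne_zero k N
      have hk := denom_factor_ne_zero k N
      have hNx : (N - x : ℝ) = (2 * N - 5 - 6 * k) / 2 := by rw [hx]; push_cast; ring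
      rw [hs, denom_succ, sub_eq_iff_eq_add.1 hPN, hNx]
      field_simp
    · beta_reduce
      rw [if_pos rfl, hc, div_mul_cancel₀ _ hf]

theorem sum_fin_filter_le {n : ℕ} (k : Fin n) (f : ℕ → ℝ) :
    ∑ j : Fin n with j ≤ k, f j = ∑ j ∈ Finset.range (k + 1), f j := by
  refine Finset.sum_bij (fun j _ => (j : ℕ)) ?_ ?_ ?_ ?_
  · intro j hj
    exact Finset.mem_range.2 (Nat.lt_succ_of_le (Finset.mem_filter.1 hj).2)
  · exact fun _ _ _ _ h => Fin.ext h
  · intro j hj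
    have hjk := Finset.mem_range.1 hj
    refine ⟨⟨j, by omega⟩, ?_, rfl⟩
    simp only [Finset.mem_filter, Finset.mem_univ, true_and, Fin.le_def]
    omega
  · exact fun _ _ => rfl

theorem det_mul_numer_div_denom (m : ℕ → ℝ) (n : ℕ) :
    (Matrix.of fun k N : Fin n =>
      m N * ((numer k).eval ((N : ℕ) : ℝ) / denom k (N : ℕ))).det =
    ∏ N ∈ Finset.range n, m N * ((numer N).eval (3 * N - 1 / 2 : ℝ) /
      (descPochhammer ℝ N).eval (3 * N - 1 / 2 : ℝ)) * (N.factorial / denom N N) := by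
  choose L hL hL' using fun k => exists_expansion k (numer k) (natDegree_numer k).1
  have h : (Matrix.of fun k N : Fin n =>
      m N * ((numer k).eval ((N : ℕ) : ℝ) / denom k (N : ℕ))) =
      (Matrix.of fun k j : Fin n => if j ≤ k then L k j else 0) *
      (Matrix.of fun j N : Fin n =>
        m N * (((N : ℕ).descFactorial j : ℝ) / denom j (N : ℕ))) := by
    ext k N
    simp only [Matrix.mul_apply, Matrix.of_apply, hL, ite_mul, zero_mul]
    rw [← Finset.sum_filter, Finset.mul_sum, sum_fin_filter_le k fun j =>
      L k j * (m N * (((N : ℕ).descFactorial j : ℝ) / denom j (N : ℕ)))]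
    exact Finset.sum_congr rfl fun j _ => by ring
  rw [h, Matrix.det_mul, Matrix.det_of_isLowerTriangular, Matrix.det_of_isUpperTriangular,
    ← Finset.prod_mul_distrib, ← Fin.prod_univ_eq_prod_range (fun N => m N *
      ((numer N).eval (3 * N - 1 / 2 : ℝ) /
      (descPochhammer ℝ N).eval (3 * N - 1 / 2 : ℝ)) * (N.factorial / denom N N))]
  · refine Finset.prod_congr rfl fun N _ => ?_
    simp only [Matrix.of_apply, le_refl, if_true, Nat.descFactorial_self]
    rw [← hL', mul_div_cancel_right₀ _ (descPochhammer_eval_pos N).ne']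
    ring
  · intro i j hij
    simp only [id] at hij
    simp [Nat.descFactorial_of_lt (Fin.lt_def.1 hij)]
  · intro i j hij
    exact if_neg (not_le.2 hij)

theorem det_coeff_eq_det_coeff_mul (g E : ℕ → ℝ⟦X⟧) (hE : ∀ N, constantCoeff (E N) = 1) (n : ℕ) :
    (Matrix.of fun k j : Fin n => coeff (j : ℕ) (g k)).det =
      (Matrix.of fun k N : Fin n => coeff (N : ℕ) (g k * E N)).det := by
  have h : (Matrix.of fun k N : Fin n => coeff (N : ℕ) (g k * E N)) =
      (Matrix.of fun k j : Fin n => coeff (j : ℕ) (g k)) *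
      (Matrix.of fun j N : Fin n => if j ≤ N then coeff (N - j : ℕ) (E N) else 0) := by
    ext k N
    simp only [Matrix.mul_apply, Matrix.of_apply, mul_ite, mul_zero]
    rw [← Finset.sum_filter, coeff_mul, Finset.Nat.sum_antidiagonal_eq_sum_range_succ_mk,
      sum_fin_filter_le N fun j => coeff j (g k) * coeff (N - j : ℕ) (E N)]
  rw [h, Matrix.det_mul, Matrix.det_of_isUpperTriangular
    (M := Matrix.of fun j N : Fin n => if j ≤ N then coeff (N - j : ℕ) (E N) else 0)]
  · simp [hE]
  · intro i j hij
    exact if_neg (not_le.2 hij)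

theorem numer_contiguity (x : ℝ) (k : ℕ) :
    8 * (2 * x + 3) * (2 * x + 5) * (numer (k + 1)).eval (x + 3) =
      (64 * x - 40 - 210 * k + 96 * k * x - 243 * k ^ 2 + 36 * k ^ 2 * x - 81 * k ^ 3) *
        (numer k).eval x
      + (400 + 224 * x + 32 * x ^ 2 + 396 * k + 96 * k * x + 108 * k ^ 2) *
        (numer (k + 1)).eval x := by
  induction k using Nat.twoStepInduction with
  | zero =>
    rw [zero_add, numer_zero_eval, numer_one_eval, numer_one_eval]
    push_cast
    ring
  | one =>
    rw [numer_succ_succ_eval, numer_succ_succ_eval, numer_zero_eval, zero_add, numer_zero_eval,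
      numer_one_eval, numer_one_eval]
    push_cast
    ring
  | more k h1 h2 =>
    rw [numer_succ_succ_eval (k + 1), numer_succ_succ_eval (k + 1)]
    rw [numer_succ_succ_eval k x] at h2 ⊢
    push_cast at *
    linear_combination (x + 3 - (3 * (k + 1) + 1)) * (2 * (x + 3) - (5 + 6 * (k + 1))) / 4 * h1
      - (20 * (x + 3) + (21 * (k + 1) + 43)) / 4 * h2

theorem numer_diagonal (k : ℕ) : (numer (k + 1)).eval (3 * k - 1 / 2 : ℝ) =
    -(81 * k + 12) / 4 * (numer k).eval (3 * k - 1 / 2 : ℝ) := by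
  cases k with
  | zero => rw [zero_add, numer_one_eval, numer_zero_eval]; push_cast; ring
  | succ k => rw [numer_succ_succ_eval]; push_cast; ring

/-- The diagonal entries of the lower triangular factor. -/
noncomputable def diagEntry (k : ℕ) : ℝ :=
  (numer k).eval (3 * k - 1 / 2 : ℝ) / (descPochhammer ℝ k).eval (3 * k - 1 / 2 : ℝ)

theorem descPochhammer_eval_succ (k : ℕ) :
    (descPochhammer ℝ (k + 1)).eval (3 * (k + 1 : ℕ) - 1 / 2 : ℝ) *
        ((2 * k + 3 / 2) * (2 * k + 1 / 2)) =
      (3 * k + 5 / 2) * (3 * k + 3 / 2) * (3 * k + 1 / 2) *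
        (descPochhammer ℝ k).eval (3 * k - 1 / 2 : ℝ) := by
  have h : (descPochhammer ℝ (k + 3)).eval (3 * (k + 1 : ℕ) - 1 / 2 : ℝ) =
      (3 * k + 5 / 2) * (3 * k + 3 / 2) * (3 * k + 1 / 2) *
        (descPochhammer ℝ k).eval (3 * k - 1 / 2 : ℝ) := by
    simp only [descPochhammer_eval_eq_prod_range, Finset.prod_range_succ']
    rw [Finset.prod_congr rfl fun j _ => show
      (3 * (k + 1 : ℕ) - 1 / 2 - (j + 1 + 1 + 1 : ℕ) : ℝ) = 3 * k - 1 / 2 - j by push_cast; ring]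
    push_cast
    ring
  rw [← h]
  simp only [descPochhammer_eval_eq_prod_range, Finset.prod_range_succ]
  push_cast
  ring

theorem diagEntry_zero : diagEntry 0 = 1 := by simp [diagEntry, numer]

theorem diagEntry_succ (k : ℕ) : diagEntry (k + 1) * ((3 * k + 1) * (3 * k + 2)) =
    -4 * (4 * k + 1) * (4 * k + 3) * diagEntry k := by
  have h := numer_contiguity (3 * k - 1 / 2) k
  have hf := descPochhammer_eval_succ k
  have h1 := (descPochhammer_eval_pos k).ne'
  have h2 := (descPochhammer_eval_pos (k + 1)).ne'
  rw [numer_diagonal, show (3 * k - 1 / 2 + 3 : ℝ) = 3 * (k + 1 : ℕ) - 1 / 2 by push_cast; ring]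
    at h
  rw [diagEntry, diagEntry]
  generalize (numer (k + 1)).eval (3 * (k + 1 : ℕ) - 1 / 2 : ℝ) = w' at *
  generalize (numer k).eval (3 * k - 1 / 2 : ℝ) = w at *
  generalize (descPochhammer ℝ (k + 1)).eval (3 * (k + 1 : ℕ) - 1 / 2 : ℝ) = f' at *
  generalize (descPochhammer ℝ k).eval (3 * k - 1 / 2 : ℝ) = f at *
  have hw : w' * ((3 * k + 1) * (3 * k + 2)) =
      -6 * (6 * k + 1) * (2 * k + 1) * (6 * k + 5) * w := by
    linear_combination h / 32
  rw [div_mul_eq_mul_div, mul_div_assoc', div_eq_div_iff h2 h1]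
  linear_combination f * hw + 16 * w * hf

theorem denom_diagonal_add_three (N : ℕ) : denom (N + 3) (N + 3 : ℕ) =
    (2 * N + 1) * (4 * N + 5) * (4 * N + 11) * denom N N := by
  simp only [denom]
  rw [Finset.prod_range_succ', Finset.prod_congr rfl fun j _ => show
      (2 * (N + 3 : ℕ) - 5 - 6 * (j + 1 : ℕ) : ℝ) = 2 * N - 5 - 6 * j by push_cast; ring,
    Finset.prod_range_succ, Finset.prod_range_succ]
  push_cast
  ring

theorem factor_eq (m : ℕ → ℝ) (h0 : m 0 = 1) (h1 : m 1 = 4) (h2 : m 2 = 6)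
    (hm : ∀ N : ℕ, m (N + 3) * ((N + 1) * (N + 2) * (N + 3)) =
      -8 * (2 * N + 1) * (2 * N + 3) * (2 * N + 5) * m N) (N : ℕ) :
    m N * diagEntry N * (N.factorial / denom N N) =
      2 ^ N * ((4 * N).factorial * Real.Gamma ((N + 2) / 3)
        / ((3 * N).factorial * Real.Gamma ((4 * N + 2) / 3))) := by
  have d0 := diagEntry_zero
  have d1 := diagEntry_succ 0
  have d2 := diagEntry_succ 1
  norm_num [d0] at d1 d2
  induction N using Nat.strongRec with
  | ind N ih =>
  match N, ih with
  | 0, _ =>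
    simp [h0, d0, denom, div_self (Real.Gamma_pos_of_pos (show (0 : ℝ) < 2 / 3 by norm_num)).ne']
  | 1, _ =>
    have h : diagEntry 1 = -6 := by linarith
    have hG : Real.Gamma 2 = 1 := Real.Gamma_two
    norm_num [h1, h, denom, hG, Nat.factorial]
  | 2, _ =>
    have h : diagEntry 2 = 42 := by linarith
    have hG : Real.Gamma (10 / 3) = 7 / 3 * (4 / 3 * Real.Gamma (4 / 3)) := by
      rw [← Real.Gamma_add_one (by norm_num), show (4 / 3 + 1 : ℝ) = 7 / 3 by norm_num,
        ← Real.Gamma_add_one (by norm_num)]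
      norm_num
    have hG' := (Real.Gamma_pos_of_pos (show (0 : ℝ) < 4 / 3 by norm_num)).ne'
    norm_num [h2, h, denom, hG, Nat.factorial, Finset.prod_range_succ]
    field_simp
    norm_num
  | N + 3, ih =>
    have hN := ih N (by omega)
    have e1 := diagEntry_succ N
    have e2 := diagEntry_succ (N + 1)
    have e3 := diagEntry_succ (N + 2)
    have hmN := hm N
    rw [← eq_div_iff (by positivity)] at e1 e2 e3 hmN
    have hD := denom_ne_zero N N
    have hG : Real.Gamma (((N + 3 : ℕ) + 2 : ℝ) / 3) = (N + 2) / 3 * Real.Gamma ((N + 2) / 3) := by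
      rw [← Real.Gamma_add_one (by positivity)]
      congr 1; push_cast; ring
    have hH : Real.Gamma ((4 * (N + 3 : ℕ) + 2 : ℝ) / 3) = (4 * N + 11) / 3 * ((4 * N + 8) / 3 *
        ((4 * N + 5) / 3 * ((4 * N + 2) / 3 * Real.Gamma ((4 * N + 2) / 3)))) := by
      rw [← Real.Gamma_add_one (by positivity),
        show ((4 * N + 2) / 3 + 1 : ℝ) = (4 * N + 5) / 3 by ring,
        ← Real.Gamma_add_one (by positivity),
        show ((4 * N + 5) / 3 + 1 : ℝ) = (4 * N + 8) / 3 by ring,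
        ← Real.Gamma_add_one (by positivity),
        show ((4 * N + 8) / 3 + 1 : ℝ) = (4 * N + 11) / 3 by ring,
        ← Real.Gamma_add_one (by positivity)]
      congr 1; push_cast; ring
    have hH0 := (Real.Gamma_pos_of_pos (show (0 : ℝ) < (4 * N + 2) / 3 by positivity)).ne'
    calc m (N + 3) * diagEntry (N + 3) * ((N + 3).factorial / denom (N + 3) (N + 3 : ℕ))
      _ = 512 * (2 * N + 3) * (2 * N + 5) * ((4 * N + 1) * (4 * N + 3) * (4 * N + 7) *
            (4 * N + 9)) / ((3 * N + 1) * (3 * N + 2) * (3 * N + 4) * (3 * N + 5) * (3 * N + 7) *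
            (3 * N + 8)) * (m N * diagEntry N * (N.factorial / denom N N)) := by
        rw [hmN, e3, e2, e1, denom_diagonal_add_three, Nat.factorial_succ, Nat.factorial_succ,
          Nat.factorial_succ]
        generalize denom N N = D at *
        push_cast
        field_simp
        ring
      _ = _ := by
        rw [hN, hG, hH, show 4 * (N + 3) = 4 * N + 12 by ring, show 3 * (N + 3) = 3 * N + 9 by ring]
        simp only [Nat.factorial_succ]
        generalize Real.Gamma ((4 * N + 2) / 3) = H at *
        push_cast
        field_simp
        ring

theorem initial_moments {E : ℕ → ℝ⟦X⟧} (hE : ∀ N, constantCoeff (E N) = 1)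
    (hrec : ∀ N k : ℕ,
      (3 * k + 1 - N : ℝ) * coeff N (rowSeries k * E N)
        + (21 * k + 43 + 20 * N) * coeff N (rowSeries (k + 1) * E N)
        - 4 * (6 * k + 11 - 2 * N) * coeff N (rowSeries (k + 2) * E N) = 0)
    (hone : ∀ N : ℕ, (5 - 2 * N : ℝ) * coeff N (rowSeries 1 * E N) =
      (5 + 4 * N) * coeff N (rowSeries 0 * E N)) :
    coeff 0 (rowSeries 0 * E 0) = 1 ∧ coeff 1 (rowSeries 0 * E 1) = 4 ∧
      coeff 2 (rowSeries 0 * E 2) = 6 := by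
  have hE' (N : ℕ) : coeff 0 (E N) = 1 := by simpa using hE N
  have c (k j : ℕ) (hj : j ≠ 0) := coeff_rowSeries k j hj
  have c01 : coeff 1 (rowSeries 0) = 4 := by rw [c _ _ one_ne_zero]; norm_num [binom]
  have c11 : coeff 1 (rowSeries 1) = 12 := by
    rw [c _ _ one_ne_zero]; norm_num [binom, Finset.prod_range_succ, Nat.factorial]
  have c21 : coeff 1 (rowSeries 2) = 21 := by
    rw [c _ _ one_ne_zero]; norm_num [binom, Finset.prod_range_succ, Nat.factorial]
  have c02 : coeff 2 (rowSeries 0) = 10 := by rw [c _ _ two_ne_zero]; norm_num [binom]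
  have c12 : coeff 2 (rowSeries 1) = 90 := by
    rw [c _ _ two_ne_zero]; norm_num [binom, Finset.prod_range_succ, Nat.factorial]
  have c22 : coeff 2 (rowSeries 2) = 252 := by
    rw [c _ _ two_ne_zero]; norm_num [binom, Finset.prod_range_succ, Nat.factorial]
  have h1 (k : ℕ) : coeff 1 (rowSeries k * E 1) = coeff 1 (E 1) + coeff 1 (rowSeries k) := by
    rw [coeff_mul, Finset.Nat.sum_antidiagonal_eq_sum_range_succ_mk]
    simp [Finset.sum_range_succ, coeff_zero_rowSeries, hE', -coeff_zero_eq_constantCoeff]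
  have h2 (k : ℕ) : coeff 2 (rowSeries k * E 2) =
      coeff 2 (E 2) + coeff 1 (rowSeries k) * coeff 1 (E 2) + coeff 2 (rowSeries k) := by
    rw [coeff_mul, Finset.Nat.sum_antidiagonal_eq_sum_range_succ_mk]
    simp [Finset.sum_range_succ, coeff_zero_rowSeries, hE', -coeff_zero_eq_constantCoeff]
  have o1 := hone 1
  have o2 := hone 2
  have r2 := hrec 2 0
  simp only [h1, h2, c01, c11, c21, c02, c12, c22, zero_add] at o1 o2 r2 ⊢
  push_cast at o1 o2 r2
  refine ⟨?_, by linarith, by linarith⟩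
  rw [coeff_zero_eq_constantCoeff_apply, map_mul, hE, mul_one,
    ← coeff_zero_eq_constantCoeff_apply, coeff_zero_rowSeries]

theorem det_coeff_rowSeries (n : ℕ) :
    (Matrix.of fun k j : Fin n => coeff (j : ℕ) (rowSeries k)).det =
      ∏ N ∈ Finset.range n, 2 ^ N * ((4 * N).factorial * Real.Gamma ((N + 2) / 3)
        / ((3 * N).factorial * Real.Gamma ((4 * N + 2) / 3))) := by
  obtain ⟨E, hE, hrec, hone, hshift⟩ := exists_weights
  have hnum (N k : ℕ) := (eq_numer_div_denom (M := fun k N => coeff N (rowSeries k * E N))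
    hrec hone k N).1
  obtain ⟨m0, m1, m2⟩ := initial_moments hE hrec hone
  rw [det_coeff_eq_det_coeff_mul (fun k => rowSeries k) E hE]
  refine (congrArg Matrix.det (Matrix.ext fun (k N : Fin n) => hnum N k)).trans
    ((det_mul_numer_div_denom (fun N => coeff N (rowSeries 0 * E N)) n).trans ?_)
  exact Finset.prod_congr rfl fun N _ =>
    factor_eq (fun N => coeff N (rowSeries 0 * E N)) m0 m1 m2
      (zero_add_three (M := fun k N => coeff N (rowSeries k * E N)) hnum hshift) N

end TwentyVertex

theorem stmt_5 (n : ℕ) (hn : 0 < n) :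
    (Matrix.of fun i j : Fin n =>
        (3 : ℝ) ^ (j : ℕ) * binom (3 * ((i : ℕ) : ℤ) + ((j : ℕ) : ℤ)) (3 * (i : ℕ))
          + binom (3 * ((i : ℕ) : ℤ) - ((j : ℕ) : ℤ)) (3 * (i : ℕ))).det =
      2 * 2 ^ (n * (n - 1) / 2) * ∏ i ∈ Finset.Icc 1 n,
          Real.Gamma (4 * (i : ℝ) - 3) * Real.Gamma (((i : ℝ) + 1) / 3)
            / (Real.Gamma (3 * (i : ℝ) - 2) * Real.Gamma ((4 * (i : ℝ) - 2) / 3)) := by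
  have h2 : ∏ j : Fin n, (if (j : ℕ) = 0 then (2 : ℝ) else 1) = 2 := by
    obtain ⟨n, rfl⟩ := Nat.exists_eq_succ_of_ne_zero hn.ne'
    simp
  simp only [TwentyVertex.entry_eq]
  have hdet := Matrix.det_mul_row (fun j : Fin n => if (j : ℕ) = 0 then (2 : ℝ) else 1)
    (Matrix.of fun k j : Fin n => PowerSeries.coeff (j : ℕ) (TwentyVertex.rowSeries k))
  simp only [Matrix.of_apply] at hdet
  rw [hdet, h2, TwentyVertex.det_coeff_rowSeries, Finset.prod_mul_distrib, mul_assoc,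
    Finset.prod_pow_eq_pow_sum, Finset.sum_range_id, Finset.range_eq_Ico,
    ← Finset.Ico_add_one_right_eq_Icc, Finset.prod_Ico_eq_prod_range _ 1, Nat.add_sub_cancel]
  congr 2
  rw [← Finset.range_eq_Ico]
  refine Finset.prod_congr rfl fun N _ => ?_
  rw [← Real.Gamma_nat_eq_factorial, ← Real.Gamma_nat_eq_factorial]
  push_cast
  ring_nf
end
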